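/- For every integer n ≥ 1: N(3,8;4n) = C(2,8;4n); and for every integer n ≥ 0: N(3,8;4n+1) = C(2,8;4n+1). -/

import Mathlib

/-- The rank of a partition: its largest part minus its number of parts. -/
def partitionRank {n : ℕ} (π : n.Partition) : ℤ :=
  (π.parts.sup : ℤ) - π.parts.card

/-- The crank of a partition: the largest part if there are no parts equal to 1,
otherwise the number of parts larger than the number of ones minus the number of ones. -/
def partitionCrank {n : ℕ} (π : n.Partition) : ℤ :=
  if π.parts.count 1 = 0 then (π.parts.sup : ℤ)
  else ((π.parts.filter (fun x => π.parts.count 1 < x)).card : ℤ) - π.parts.count 1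

/-- `N(a,M;n)`: the number of partitions of `n` whose rank is congruent to `a` modulo `M`. -/
def rankCount (a : ℤ) (M : ℕ) (n : ℕ) : ℕ :=
  (Finset.univ.filter (fun π : n.Partition => partitionRank π % M = a % M)).card

/-- `C(a,M;n)`: the number of partitions of `n` whose crank is congruent to `a` modulo `M`. -/
def crankCount (a : ℤ) (M : ℕ) (n : ℕ) : ℕ :=
  (Finset.univ.filter (fun π : n.Partition => partitionCrank π % M = a % M)).card

namespace RC
open PowerSeries

noncomputable def ser {ι : Type} (e c : ι → ℤ) : ℤ⟦X⟧ :=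
  PowerSeries.mk fun N => ∑ᶠ i, if e i = (N : ℤ) then c i else 0

def Adm {ι : Type} (e c : ι → ℤ) : Prop :=
  (∀ i, c i ≠ 0 → 0 ≤ e i) ∧ ∀ N : ℤ, {i | c i ≠ 0 ∧ e i ≤ N}.Finite

noncomputable def coeffZ (F : ℤ⟦X⟧) (M : ℤ) : ℤ := if 0 ≤ M then coeff M.toNat F else 0

theorem coeffZ_nat (F : ℤ⟦X⟧) (n : ℕ) : coeffZ F n = coeff n F := by simp [coeffZ]

variable {ι κ : Type}

theorem coeff_ser (e c : ι → ℤ) (N : ℕ) :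
    coeff N (ser e c) = ∑ᶠ i, if e i = (N : ℤ) then c i else 0 := by
  simp [ser]

theorem Adm.fin {e c : ι → ℤ} (h : Adm e c) (N : ℤ) :
    (Function.support fun i => if e i = N then c i else 0).Finite := by
  refine (h.2 N).subset ?_
  intro i hi
  simp only [Function.mem_support, ne_eq, ite_eq_right_iff, Classical.not_imp] at hi
  exact ⟨hi.2, hi.1.le⟩

theorem coeffZ_ser {e c : ι → ℤ} (h : Adm e c) (M : ℤ) :
    coeffZ (ser e c) M = ∑ᶠ i, if e i = M then c i else 0 := by
  unfold coeffZ
  split_ifs with hM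
  · rw [coeff_ser, Int.toNat_of_nonneg hM]
  · symm
    refine finsum_eq_zero_of_forall_eq_zero fun i => ?_
    split_ifs with h1
    · by_contra h2
      exact hM (h1 ▸ h.1 i h2)
    · rfl

theorem Adm.comp {e c : ι → ℤ} (h : Adm e c) (f : κ ≃ ι) : Adm (e ∘ f) (c ∘ f) := by
  refine ⟨fun i hi => h.1 _ hi, fun N => ?_⟩
  exact (h.2 N).preimage f.injective.injOn

theorem ser_comp (e c : ι → ℤ) (f : κ ≃ ι) : ser (e ∘ f) (c ∘ f) = ser e c := by
  ext N
  rw [coeff_ser, coeff_ser]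
  exact finsum_comp_equiv f (f := fun i => if e i = (N : ℤ) then c i else 0)

theorem Adm.mul {e₁ c₁ : ι → ℤ} {e₂ c₂ : κ → ℤ} (h₁ : Adm e₁ c₁) (h₂ : Adm e₂ c₂) :
    Adm (fun p : ι × κ => e₁ p.1 + e₂ p.2) (fun p => c₁ p.1 * c₂ p.2) := by
  refine ⟨fun p hp => ?_, fun N => ?_⟩
  · have := h₁.1 p.1 (left_ne_zero_of_mul hp)
    have := h₂.1 p.2 (right_ne_zero_of_mul hp)
    simp only; omega
  · refine ((h₁.2 N).prod (h₂.2 N)).subset ?_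
    rintro ⟨i, j⟩ ⟨hp, hN⟩
    have a1 := left_ne_zero_of_mul hp
    have a2 := right_ne_zero_of_mul hp
    have b1 := h₁.1 i a1
    have b2 := h₂.1 j a2
    simp only at hN b1 b2
    exact ⟨⟨a1, by show e₁ i ≤ N; omega⟩, ⟨a2, by show e₂ j ≤ N; omega⟩⟩

theorem coeff_ser_mul {e c : ι → ℤ} (h : Adm e c) (F : ℤ⟦X⟧) (N : ℕ) :
    coeff N (ser e c * F) = ∑ᶠ i, c i * coeffZ F (N - e i) := by
  classical
  set s := (h.2 N).toFinset with hs
  have hmem : ∀ i, i ∈ s ↔ c i ≠ 0 ∧ e i ≤ N := by intro i; simp [hs]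
  rw [finsum_eq_sum_of_support_subset (s := s), coeff_mul]
  · have : ∀ p ∈ Finset.HasAntidiagonal.antidiagonal N, coeff p.1 (ser e c) * coeff p.2 F =
        ∑ i ∈ s, if e i = (p.1 : ℤ) then c i * coeff p.2 F else 0 := by
      intro p hp
      rw [coeff_ser, finsum_eq_sum_of_support_subset (s := s), Finset.sum_mul]
      · refine Finset.sum_congr rfl fun i _ => ?_
        split_ifs <;> simp
      · intro i hi
        simp only [Function.mem_support, ne_eq, ite_eq_right_iff, Classical.not_imp] at hi
        have := Finset.HasAntidiagonal.mem_antidiagonal.1 hp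
        rw [Finset.mem_coe, hmem]
        exact ⟨hi.2, by omega⟩
    rw [Finset.sum_congr rfl this, Finset.sum_comm]
    refine Finset.sum_congr rfl fun i hi => ?_
    obtain ⟨h1, h2⟩ := (hmem i).1 hi
    have h3 := h.1 i h1
    rw [Finset.sum_eq_single ((e i).toNat, ((N : ℤ) - e i).toNat)]
    · rw [if_pos (by simp [h3]), coeffZ, if_pos (by omega)]
    · rintro ⟨p, q⟩ hp hne
      rw [if_neg]
      rintro hh
      apply hne
      have := Finset.HasAntidiagonal.mem_antidiagonal.1 hp
      simp only at this hh
      ext <;> simp only <;> omega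
    · intro hn
      exfalso; apply hn
      rw [Finset.HasAntidiagonal.mem_antidiagonal]; simp only; omega
  · intro i hi
    have a1 := left_ne_zero_of_mul hi
    have a2 := right_ne_zero_of_mul hi
    rw [Finset.mem_coe, hmem]
    refine ⟨a1, ?_⟩
    by_contra hlt
    apply a2
    rw [coeffZ, if_neg (by omega)]

theorem finsum_prod' {f : ι × κ → ℤ} (h : (Function.support f).Finite) :
    ∑ᶠ p, f p = ∑ᶠ i, ∑ᶠ j, f (i, j) := finsum_curry f h

theorem ser_mul {e₁ c₁ : ι → ℤ} {e₂ c₂ : κ → ℤ} (h₁ : Adm e₁ c₁) (h₂ : Adm e₂ c₂) :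
    ser e₁ c₁ * ser e₂ c₂ =
      ser (fun p : ι × κ => e₁ p.1 + e₂ p.2) (fun p => c₁ p.1 * c₂ p.2) := by
  ext N
  rw [coeff_ser_mul h₁, coeff_ser, finsum_prod' ((h₁.mul h₂).fin N)]
  refine finsum_congr fun i => ?_
  rw [coeffZ_ser h₂, _root_.mul_finsum]
  refine finsum_congr fun j => ?_
  by_cases h : e₂ j = N - e₁ i
  · rw [if_pos h, if_pos (by simp only; omega)]
  · rw [if_neg h, if_neg (by simp only; omega), mul_zero]

theorem ser_expand (d : ℕ) (hd : d ≠ 0) (e c : ι → ℤ) :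
    PowerSeries.expand d hd (ser e c) = ser (fun i => d * e i) c := by
  ext N
  rw [coeff_expand, coeff_ser]
  split_ifs with hdv
  · obtain ⟨m, rfl⟩ := hdv
    rw [Nat.mul_div_cancel_left _ (Nat.pos_of_ne_zero hd), coeff_ser]
    refine finsum_congr fun i => ?_
    have : (d : ℤ) * e i = ((d * m : ℕ) : ℤ) ↔ e i = m := by
      push_cast
      constructor
      · intro hh; exact mul_left_cancel₀ (by exact_mod_cast hd) hh
      · intro hh; rw [hh]
    simp only [this]
  · symm
    refine finsum_eq_zero_of_forall_eq_zero fun i => ?_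
    split_ifs with h1
    · by_contra h2
      apply hdv
      have : (d : ℤ) ∣ N := ⟨e i, by simpa using h1.symm⟩
      exact_mod_cast this
    · rfl

theorem Adm.dil (d : ℕ) (hd : d ≠ 0) {e c : ι → ℤ} (h : Adm e c) :
    Adm (fun i => d * e i) c := by
  have hd' : (1:ℤ) ≤ d := by exact_mod_cast Nat.pos_of_ne_zero hd
  refine ⟨fun i hi => mul_nonneg (by positivity) (h.1 i hi), fun N => (h.2 N).subset ?_⟩
  rintro i ⟨h1, h2⟩
  have := h.1 i h1
  exact ⟨h1, by nlinarith⟩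

theorem ser_add {e c₁ c₂ : ι → ℤ} (h₁ : Adm e c₁) (h₂ : Adm e c₂) :
    ser e (fun i => c₁ i + c₂ i) = ser e c₁ + ser e c₂ := by
  ext N
  rw [map_add, coeff_ser, coeff_ser, coeff_ser, ← finsum_add_distrib (h₁.fin N) (h₂.fin N)]
  refine finsum_congr fun i => ?_
  split_ifs <;> simp

theorem ser_smul (r : ℤ) (e c : ι → ℤ) :
    ser e (fun i => r * c i) = C r * ser e c := by
  ext N
  rw [coeff_C_mul, coeff_ser, coeff_ser, _root_.mul_finsum]
  refine finsum_congr fun i => ?_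
  split_ifs <;> simp

/-- The master reindexing lemma. -/
theorem coeff_shift {e₀ : ι → ℤ} {eB cB : κ → ℤ} (h₀ : Adm e₀ (fun _ => 1)) (hB : Adm eB cB)
    (σ : κ → (ι ≃ ι)) (g : ι → κ → ℤ) (hg : ∀ i p, e₀ (σ p i) + eB p = e₀ i + g i p) (N : ℕ) :
    coeff N (ser e₀ (fun _ => 1) * ser eB cB) =
      ∑ᶠ i, ∑ᶠ p, if g i p = N - e₀ i then cB p else 0 := by
  let f : ι × κ ≃ ι × κ :=
    { toFun := fun x => (σ x.2 x.1, x.2)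
      invFun := fun x => ((σ x.2).symm x.1, x.2)
      left_inv := fun x => by simp
      right_inv := fun x => by simp }
  rw [ser_mul h₀ hB, ← ser_comp _ _ f, coeff_ser, finsum_prod' (((h₀.mul hB).comp f).fin N)]
  refine finsum_congr fun i => finsum_congr fun p => ?_
  have h1 := hg i p
  simp only [Function.comp, f, Equiv.coe_fn_mk, one_mul]
  by_cases h : g i p = N - e₀ i
  · rw [if_pos h, if_pos (by omega)]
  · rw [if_neg h, if_neg (by omega)]

theorem eq_zero_of_dvd {F : ℤ⟦X⟧} (h : ∀ M : ℕ, (X : ℤ⟦X⟧) ^ M ∣ F) : F = 0 := by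
  ext N
  rw [X_pow_dvd_iff.1 (h (N+1)) N (by omega)]; simp

noncomputable def lsum (f : ℕ → ℤ⟦X⟧) : ℤ⟦X⟧ :=
  PowerSeries.mk fun N => ∑ ν ∈ Finset.range (N + 1), coeff N (f ν)

theorem coeff_lsum {f : ℕ → ℤ⟦X⟧} (hf : ∀ ν, (X : ℤ⟦X⟧) ^ ν ∣ f ν) (N M : ℕ) (h : N < M) :
    coeff N (lsum f) = ∑ ν ∈ Finset.range M, coeff N (f ν) := by
  rw [lsum, coeff_mk]
  refine Finset.sum_subset (by intro x; simp; omega) ?_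
  intro ν _ hν
  exact X_pow_dvd_iff.1 (hf ν) N (by simpa using hν)

theorem lsum_sub_dvd {f : ℕ → ℤ⟦X⟧} (hf : ∀ ν, (X : ℤ⟦X⟧) ^ ν ∣ f ν) (M : ℕ) :
    (X : ℤ⟦X⟧) ^ M ∣ lsum f - ∑ ν ∈ Finset.range M, f ν := by
  rw [X_pow_dvd_iff]
  intro N hN
  rw [map_sub, coeff_lsum hf N M hN, map_sum, sub_self]

theorem lsum_eq {f : ℕ → ℤ⟦X⟧} (hf : ∀ ν, (X : ℤ⟦X⟧) ^ ν ∣ f ν) {F : ℤ⟦X⟧}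
    (h : ∀ M : ℕ, (X : ℤ⟦X⟧) ^ M ∣ F - ∑ ν ∈ Finset.range M, f ν) : F = lsum f := by
  rw [← sub_eq_zero]
  apply eq_zero_of_dvd
  intro M
  have := dvd_sub (h M) (lsum_sub_dvd hf M)
  simpa using this

theorem lsum_add (f g : ℕ → ℤ⟦X⟧) : lsum (fun ν => f ν + g ν) = lsum f + lsum g := by
  ext N; simp [lsum, Finset.sum_add_distrib]

theorem lsum_sub (f g : ℕ → ℤ⟦X⟧) : lsum (fun ν => f ν - g ν) = lsum f - lsum g := by
  ext N; simp [lsum]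

theorem lsum_mul {f : ℕ → ℤ⟦X⟧} (hf : ∀ ν, (X : ℤ⟦X⟧) ^ ν ∣ f ν) (F : ℤ⟦X⟧) :
    lsum (fun ν => F * f ν) = F * lsum f := by
  symm
  refine lsum_eq (fun ν => (hf ν).mul_left F) fun M => ?_
  rw [← Finset.mul_sum, ← mul_sub]
  exact (lsum_sub_dvd hf M).mul_left F

theorem lsum_succ {f : ℕ → ℤ⟦X⟧} (hf : ∀ ν, (X : ℤ⟦X⟧) ^ ν ∣ f ν) :
    lsum f = f 0 + lsum (fun ν => f (ν + 1)) := by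
  symm
  refine lsum_eq hf fun M => ?_
  have hf' : ∀ ν, (X : ℤ⟦X⟧) ^ ν ∣ f (ν+1) := fun ν => (pow_dvd_pow _ (by omega)).trans (hf (ν+1))
  have h1 := lsum_sub_dvd hf' M
  have h2 : ∑ ν ∈ Finset.range M, f ν + f M = f 0 + ∑ ν ∈ Finset.range M, f (ν + 1) := by
    rw [← Finset.sum_range_succ, Finset.sum_range_succ', add_comm]
  have h3 : f 0 + lsum (fun ν => f (ν + 1)) - ∑ ν ∈ Finset.range M, f ν =
    (lsum (fun ν => f (ν + 1)) - ∑ ν ∈ Finset.range M, f (ν + 1)) + f M := by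
    linear_combination -h2
  rw [h3]
  exact dvd_add h1 (hf M)

end RC

namespace RC
open PowerSeries

def pm (n : ℤ) : ℤ := if n % 2 = 0 then 1 else -1
def sg (n k : ℤ) : ℤ := if 0 < n ∧ 0 ≤ k then 1 else if n < 0 ∧ k < 0 then -1 else 0
def dl (M : ℤ) : ℤ := if M = 0 then 1 else 0

noncomputable def kern (r s d M : ℤ) : ℤ :=
  ∑ᶠ p : ℤ × ℤ, if d * (p.1 ^ 2 + s * p.1 + r * p.1 * p.2) = M then pm p.1 * sg p.1 p.2 else 0

theorem pm_add (a b : ℤ) : pm (a + b) = pm a * pm b := by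
  unfold pm; split_ifs <;> first | omega | simp
theorem pm_neg (a : ℤ) : pm (-a) = pm a := by
  unfold pm; split_ifs <;> first | omega | simp
theorem pm_sq (a : ℤ) : pm a * pm a = 1 := by
  unfold pm; split_ifs <;> simp
theorem pm_even {a : ℤ} (h : a % 2 = 0) : pm a = 1 := by simp [pm, h]
theorem pm_odd {a : ℤ} (h : a % 2 = 1) : pm a = -1 := by simp [pm, h]
theorem pm_congr {a b : ℤ} (h : a % 2 = b % 2) : pm a = pm b := by simp [pm, h]
theorem pm_ne (a : ℤ) : pm a ≠ 0 := by unfold pm; split_ifs <;> simp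

theorem sg_ne {n k : ℤ} (h : sg n k ≠ 0) : (0 < n ∧ 0 ≤ k) ∨ (n < 0 ∧ k < 0) := by
  unfold sg at h; split_ifs at h <;> simp_all

theorem kern_box {r s M n k : ℤ} (hr : 1 ≤ r) (h : sg n k ≠ 0)
    (hle : n ^ 2 + s * n + r * n * k ≤ M) :
    n ∈ Set.Icc (-(|s| + |M|)) (|s| + |M|) ∧ k ∈ Set.Icc (-(|s| + |M|)) (|s| + |M|) := by
  have s1 := le_abs_self s
  have s2 := neg_abs_le s
  have m1 := le_abs_self M
  have m0 := abs_nonneg M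
  rcases sg_ne h with ⟨h1, h2⟩ | ⟨h1, h2⟩
  · have hz : n + s + r * k ≤ |M| := by
      by_contra hc
      have : n * (n + s + r * k) ≤ |M| := by nlinarith
      nlinarith
    have : k ≤ r * k := by nlinarith
    constructor <;> constructor <;> linarith
  · have hz : -n - s - r * k ≤ |M| := by
      by_contra hc
      have : (-n) * (-n - s - r * k) ≤ |M| := by nlinarith
      nlinarith
    have : -k ≤ r * (-k) := by nlinarith
    constructor <;> constructor <;> linarith

theorem kern_fin {r s d : ℤ} (hr : 1 ≤ r) (hd : 1 ≤ d) (M : ℤ) (c : ℤ × ℤ → ℤ)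
    (hc : ∀ p, sg p.1 p.2 = 0 → c p = 0) :
    (Function.support fun p : ℤ × ℤ =>
      if d * (p.1 ^ 2 + s * p.1 + r * p.1 * p.2) = M then c p else 0).Finite := by
  refine ((Set.finite_Icc (-(|s| + |M|)) (|s| + |M|)).prod
    (Set.finite_Icc (-(|s| + |M|)) (|s| + |M|))).subset ?_
  rintro ⟨n, k⟩ hp
  simp only [Function.mem_support, ne_eq, ite_eq_right_iff, Classical.not_imp] at hp
  obtain ⟨h1, h2⟩ := hp
  have h3 : sg n k ≠ 0 := fun h => h2 (hc (n, k) h)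
  set z := n ^ 2 + s * n + r * n * k with hz
  have h4 : z ≤ |M| := by
    rw [← h1]
    rcases le_or_gt z 0 with h | h
    · exact h.trans (abs_nonneg _)
    · rw [abs_of_pos (by positivity)]; nlinarith
  have h5 := kern_box (s := s) (M := |M|) hr h3 h4
  rw [abs_abs] at h5
  exact h5

theorem sum_odd (s d M : ℤ) (hs : s % 2 = 1) :
    ∑ᶠ n : ℤ, (if d * (n ^ 2 + s * n) = M then pm n else 0) = 0 := by
  have h := finsum_comp_equiv (Equiv.subLeft (-s))
    (f := fun n : ℤ => (if d * (n ^ 2 + s * n) = M then pm n else 0))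
  have h2 : ∑ᶠ n : ℤ, (if d * ((Equiv.subLeft (-s) n) ^ 2 + s * (Equiv.subLeft (-s) n)) = M then
      pm (Equiv.subLeft (-s) n) else 0) = ∑ᶠ n : ℤ, -(if d * (n ^ 2 + s * n) = M then pm n else 0) := by
    refine finsum_congr fun n => ?_
    have e1 : (Equiv.subLeft (-s) n) ^ 2 + s * (Equiv.subLeft (-s) n) = n ^ 2 + s * n := by
      simp only [Equiv.subLeft_apply]; ring
    have e2 : pm (Equiv.subLeft (-s) n) = - pm n := by
      simp only [Equiv.subLeft_apply]
      unfold pm; split_ifs <;> first | omega | simp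
    rw [e1, e2]; split_ifs <;> simp
  rw [h2, finsum_neg_distrib] at h
  linarith

theorem kern_refl (r s d M : ℤ) : kern r s d M = - kern r (r - s) d M := by
  let f : ℤ × ℤ ≃ ℤ × ℤ :=
    { toFun := fun p => (-p.1, -1 - p.2)
      invFun := fun p => (-p.1, -1 - p.2)
      left_inv := fun p => by ext <;> simp
      right_inv := fun p => by ext <;> simp }
  unfold kern
  rw [← finsum_neg_distrib]
  rw [← finsum_comp_equiv f]
  refine finsum_congr fun p => ?_
  have e1 : (f p).1 ^ 2 + s * (f p).1 + r * (f p).1 * (f p).2 =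
      p.1 ^ 2 + (r - s) * p.1 + r * p.1 * p.2 := by
    simp only [f, Equiv.coe_fn_mk]; ring
  have e2 : sg (f p).1 (f p).2 = - sg p.1 p.2 := by
    simp only [f, Equiv.coe_fn_mk]
    unfold sg; split_ifs <;> first | omega | simp
  have e3 : pm (f p).1 = pm p.1 := pm_neg _
  rw [e1, e2, e3]; split_ifs <;> simp

theorem kern_step {r s d : ℤ} (hr : 1 ≤ r) (hd : 1 ≤ d) (M : ℤ) (hs : s % 2 = 1) (hr2 : r % 2 = 0) :
    kern r (s - r) d M = kern r s d M - dl M := by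
  have hsh : kern r (s - r) d M = ∑ᶠ p : ℤ × ℤ, if d * (p.1 ^ 2 + s * p.1 + r * p.1 * p.2) = M then
      pm p.1 * sg p.1 (p.2 + 1) else 0 := by
    unfold kern
    rw [← finsum_comp_equiv ((Equiv.refl ℤ).prodCongr (Equiv.addRight (1:ℤ)))]
    refine finsum_congr fun p => ?_
    have : ((Equiv.refl ℤ).prodCongr (Equiv.addRight (1:ℤ))) p = (p.1, p.2 + 1) := rfl
    rw [this]
    have e1 : p.1 ^ 2 + (s - r) * p.1 + r * p.1 * (p.2 + 1) = p.1 ^ 2 + s * p.1 + r * p.1 * p.2 := by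
      ring
    simp only [e1]
  let g : ℤ × ℤ → ℤ := fun p => if p.2 = -1 then
    (if p.1 = 0 then 0 else if d * (p.1 ^ 2 + (s - r) * p.1) = M then pm p.1 else 0) else 0
  have hg : ∀ p : ℤ × ℤ, (if d * (p.1 ^ 2 + s * p.1 + r * p.1 * p.2) = M then
      pm p.1 * sg p.1 (p.2 + 1) else 0) = (if d * (p.1 ^ 2 + s * p.1 + r * p.1 * p.2) = M then
      pm p.1 * sg p.1 p.2 else 0) + g p := by
    rintro ⟨n, k⟩
    simp only [g]
    by_cases hk : k = -1
    · subst hk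
      have e : n ^ 2 + (s - r) * n = n ^ 2 + s * n + r * n * -1 := by ring
      rw [e, if_pos rfl]
      have : sg n (-1 + 1) = sg n (-1) + if n = 0 then 0 else 1 := by
        unfold sg; split_ifs <;> first | omega | simp
      rw [this]
      split_ifs <;> ring
    · rw [if_neg hk, add_zero]
      have : sg n (k + 1) = sg n k := by
        unfold sg; split_ifs <;> first | omega | simp
      rw [this]
  have hfing : (Function.support g).Finite := by
    refine ((Set.finite_Icc (-(|s - r| + |M|)) (|s - r| + |M|)).prod (Set.finite_singleton (-1))).subset ?_
    rintro ⟨n, k⟩ hp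
    have h1 : k = -1 := by by_contra h; simp [g, h] at hp
    have h2 : n ≠ 0 := by intro h; simp [g, h] at hp
    have h3 : d * (n ^ 2 + (s - r) * n) = M := by by_contra h; simp [g, h] at hp
    refine ⟨?_, h1⟩
    have h3' : d * (n * (n + (s - r))) = M := by rw [← h3]; ring
    have h5 : |n + (s - r)| ≤ |M| := by
      by_cases h0 : n + (s - r) = 0
      · rw [h0]; simp
      · rw [← h3', abs_mul, abs_mul]
        have := abs_pos.2 (show d ≠ 0 by omega)
        have := abs_pos.2 h2
        have := abs_pos.2 h0
        have h7 : 1 ≤ |d| * |n| := by nlinarith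
        nlinarith
    have := abs_le.1 h5
    have a1 := le_abs_self (s - r)
    have a2 := neg_abs_le (s - r)
    constructor <;> simp only <;> linarith
  have hsum : ∑ᶠ p, g p = - dl M := by
    rw [finsum_prod' hfing]
    have h1 : ∀ n : ℤ, ∑ᶠ k : ℤ, g (n, k) =
        (if n = 0 then 0 else if d * (n ^ 2 + (s - r) * n) = M then pm n else 0) := by
      intro n
      rw [finsum_eq_single _ (-1)]
      · simp [g]
      · intro k hk; simp [g, hk]
    have h0 := sum_odd (s - r) d M (by omega)
    have h2 : ∑ᶠ n : ℤ, (if n = 0 then dl M else 0) = dl M := by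
      rw [finsum_eq_single _ 0]
      · simp
      · intro n hn; simp [hn]
    have hf : (Function.support fun n : ℤ => ∑ᶠ k, g (n, k)).Finite := by
      refine (hfing.image Prod.fst).subset ?_
      intro n hn
      simp only [Function.mem_support, h1] at hn
      exact ⟨(n, -1), by simpa [g] using hn, rfl⟩
    have hf2 : (Function.support fun n : ℤ => (if n = 0 then dl M else 0)).Finite := by
      refine (Set.finite_singleton (0:ℤ)).subset ?_
      intro n hn; by_contra h; simp only [Set.mem_singleton_iff] at h; simp [h] at hn
    have h3 := finsum_add_distrib hf hf2
    rw [h2] at h3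
    have h4 : ∑ᶠ n : ℤ, (∑ᶠ k, g (n, k) + if n = 0 then dl M else 0) = 0 := by
      refine Eq.trans (finsum_congr fun n => ?_) h0
      rw [h1]
      by_cases hn : n = 0
      · subst hn
        simp only [if_true, dl]
        have : d * ((0:ℤ) ^ 2 + (s - r) * 0) = 0 := by ring
        rw [this]
        simp [pm, eq_comm]
      · simp [hn]
    linarith
  rw [hsh]
  simp only [hg]
  rw [finsum_add_distrib (kern_fin hr hd M _ (by intro p h; simp [h])) hfing, hsum]
  rfl

theorem kern_steps {r s d : ℤ} (hr : 1 ≤ r) (hd : 1 ≤ d) (M : ℤ) (hs : s % 2 = 1) (hr2 : r % 2 = 0)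
    (j : ℤ) : kern r (s - r * j) d M = kern r s d M - j * dl M := by
  induction j using Int.induction_on with
  | zero => simp
  | succ i ih =>
    have h := kern_step hr hd M (s := s - r * i) (by rw [Int.sub_emod, Int.mul_emod, hr2]; simp [hs]) hr2
    have e : s - r * i - r = s - r * (i + 1) := by ring
    rw [e] at h
    rw [h, ih]; ring
  | pred i ih =>
    have h := kern_step hr hd M (s := s - r * (-i - 1)) (by rw [Int.sub_emod, Int.mul_emod, hr2]; simp [hs]) hr2
    have e : s - r * (-i - 1) - r = s - r * (-i) := by ring
    rw [e] at h
    linarith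

theorem kern_two {d : ℤ} (hd : 1 ≤ d) (M l : ℤ) : kern 2 (1 - 2 * l) d M = - l * dl M := by
  have h1 := kern_refl 2 1 d M
  rw [kern_steps (by norm_num) hd M (by norm_num) (by norm_num)]
  norm_num at h1
  linarith

noncomputable def vhat (d M : ℤ) : ℤ := dl M + 4 * kern 4 1 d M

theorem kern_four {d : ℤ} (hd : 1 ≤ d) (M c : ℤ) :
    4 * kern 4 (1 - 2 * c) d M = pm c * vhat d M - (2 * c + 1) * dl M := by
  have h1 := kern_refl 4 3 d M
  norm_num at h1
  rcases Int.even_or_odd' c with ⟨j, rfl | rfl⟩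
  · have h := kern_steps (r := 4) (s := 1) (by norm_num) hd M (by norm_num) (by norm_num) j
    rw [show 1 - 2 * (2 * j) = 1 - 4 * j by ring, h, pm_even (by omega), vhat]; ring
  · have h := kern_steps (r := 4) (s := 3) (by norm_num) hd M (by norm_num) (by norm_num) (j + 1)
    rw [show 1 - 2 * (2 * j + 1) = 3 - 4 * (j + 1) by ring, h, pm_odd (by omega), vhat, h1]; ring

end RC

namespace RC
open PowerSeries

def tri (n : ℤ) : ℤ := n * (n + 1) / 2

theorem two_tri (n : ℤ) : 2 * tri n = n * (n + 1) := by
  unfold tri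
  exact Int.mul_ediv_cancel' (Int.even_mul_succ_self n).two_dvd

def T (a : ℤ) : ℤ := 2 * a ^ 2 + a

theorem T_ge (a : ℤ) : |a| ≤ T a := by
  unfold T
  rcases abs_cases a with ⟨h, h'⟩ | ⟨h, h'⟩ <;> rw [h] <;> nlinarith

theorem sq_ge (a : ℤ) : |a| ≤ a ^ 2 := by
  rcases abs_cases a with ⟨h, h'⟩ | ⟨h, h'⟩ <;> rw [h] <;> nlinarith

theorem adm1 {e : ℤ → ℤ} (h : ∀ a, |a| ≤ e a) (c : ℤ → ℤ) : Adm e c := by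
  refine ⟨fun i _ => (abs_nonneg i).trans (h i), fun N => (Set.finite_Icc (-N) N).subset ?_⟩
  rintro i ⟨_, hi⟩
  exact abs_le.1 ((h i).trans hi)

theorem adm2 {e c : ℤ × ℤ → ℤ} (h : ∀ p, c p ≠ 0 → |p.1| ≤ e p ∧ |p.2| ≤ e p) : Adm e c := by
  refine ⟨fun i hi => (abs_nonneg _).trans (h i hi).1, fun N =>
    ((Set.finite_Icc (-N) N).prod (Set.finite_Icc (-N) N)).subset ?_⟩
  rintro i ⟨h0, hi⟩
  have := h i h0
  exact ⟨abs_le.1 (this.1.trans hi), abs_le.1 (this.2.trans hi)⟩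

def cS (p : ℤ × ℤ) : ℤ := pm p.1 * sg p.1 p.2
def ey (p : ℤ × ℤ) : ℤ := tri p.1 + 2 * p.1 * p.2
def eV (d : ℕ) (p : ℤ × ℤ) : ℤ := d * (p.1 ^ 2 + p.1 + 4 * p.1 * p.2)
def eA (j : ℤ) (p : ℤ × ℤ) : ℤ := tri p.1 + p.1 ^ 2 + 2 * p.1 + j * p.1 + 8 * p.1 * p.2
def eB (p : ℤ × ℤ) : ℤ := tri p.1 + p.1 + 4 * p.1 * p.2
def cN (p : ℤ × ℤ) : ℤ := - (pm p.1 * sg p.1 p.2)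

theorem cS_ne {p : ℤ × ℤ} (h : cS p ≠ 0) : (0 < p.1 ∧ 0 ≤ p.2) ∨ (p.1 < 0 ∧ p.2 < 0) :=
  sg_ne (right_ne_zero_of_mul h)
theorem cN_ne {p : ℤ × ℤ} (h : cN p ≠ 0) : (0 < p.1 ∧ 0 ≤ p.2) ∨ (p.1 < 0 ∧ p.2 < 0) :=
  cS_ne (p := p) (by intro h'; apply h; unfold cN; unfold cS at h'; rw [h', neg_zero])

theorem adm_ey : Adm ey cS := by
  refine adm2 fun p hp => ?_
  obtain ⟨n, k⟩ := p
  have ht := two_tri n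
  rcases cS_ne hp with ⟨h1, h2⟩ | ⟨h1, h2⟩ <;> simp only [ey] at *
  · rw [abs_of_pos h1, abs_of_nonneg h2]
    constructor <;> nlinarith [mul_nonneg h1.le h2, mul_nonneg (show 0 ≤ n - 1 by omega) h2]
  · rw [abs_of_neg h1, abs_of_neg h2]
    have := mul_nonneg (show 0 ≤ -n - 1 by omega) (show 0 ≤ -k - 1 by omega)
    constructor <;> nlinarith

theorem adm_eB : Adm eB cN := by
  refine adm2 fun p hp => ?_
  obtain ⟨n, k⟩ := p
  have ht := two_tri n
  rcases cN_ne hp with ⟨h1, h2⟩ | ⟨h1, h2⟩ <;> simp only [eB] at *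
  · rw [abs_of_pos h1, abs_of_nonneg h2]
    constructor <;> nlinarith [mul_nonneg h1.le h2, mul_nonneg (show 0 ≤ n - 1 by omega) h2]
  · rw [abs_of_neg h1, abs_of_neg h2]
    have := mul_nonneg (show 0 ≤ -n - 1 by omega) (show 0 ≤ -k - 1 by omega)
    constructor <;> nlinarith

theorem adm_eA (j : ℤ) (h0 : 0 ≤ j) (hj : j ≤ 1) : Adm (eA j) cN := by
  refine adm2 fun p hp => ?_
  obtain ⟨n, k⟩ := p
  have ht := two_tri n
  rcases cN_ne hp with ⟨h1, h2⟩ | ⟨h1, h2⟩ <;> simp only [eA] at *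
  · rw [abs_of_pos h1, abs_of_nonneg h2]
    have := mul_nonneg h0 h1.le
    constructor <;> nlinarith [mul_nonneg h1.le h2, mul_nonneg (show 0 ≤ n - 1 by omega) h2]
  · rw [abs_of_neg h1, abs_of_neg h2]
    have := mul_nonneg (show 0 ≤ -n - 1 by omega) (show 0 ≤ -k - 1 by omega)
    have := mul_nonneg (show 0 ≤ -n by omega) (show 0 ≤ 1 - j by omega)
    constructor <;> nlinarith

theorem adm_eV (d : ℕ) (hd : d ≠ 0) : Adm (eV d) cS := by
  have h : Adm (fun p : ℤ × ℤ => (p.1 ^ 2 + p.1 + 4 * p.1 * p.2)) cS := by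
    have := adm_ey.dil 2 (by norm_num)
    convert this using 2 with p
    have ht := two_tri p.1
    simp only [ey]; push_cast; linarith
  exact h.dil d hd

noncomputable def psi : ℤ⟦X⟧ := ser T fun _ => 1
noncomputable def psim : ℤ⟦X⟧ := ser T pm
noncomputable def jac : ℤ⟦X⟧ := ser T fun a => 4 * a + 1
noncomputable def phi : ℤ⟦X⟧ := ser (fun b : ℤ => b ^ 2) fun _ => 1
noncomputable def phim : ℤ⟦X⟧ := ser (fun b : ℤ => b ^ 2) pm
noncomputable def vS : ℤ⟦X⟧ := 1 + C 4 * ser ey cS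
noncomputable def VS (d : ℕ) : ℤ⟦X⟧ := 1 + C 4 * ser (eV d) cS

noncomputable abbrev ex (d : ℕ) [NeZero d] (F : ℤ⟦X⟧) : ℤ⟦X⟧ := PowerSeries.expand d (NeZero.ne d) F

theorem ex2_vS : ex 2 vS = VS 1 := by
  unfold vS VS ex
  rw [map_add, map_mul, map_one, expand_C, ser_expand]
  congr 3
  funext p
  have ht := two_tri p.1
  simp only [ey, eV]; push_cast; linarith

theorem ex2_VS : ex 2 (VS 1) = VS 2 := by
  unfold VS ex
  rw [map_add, map_mul, map_one, expand_C, ser_expand]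
  congr 3
  funext p
  simp only [eV]; push_cast; ring

/-- half shift -/
def hs (n : ℤ) : ℤ ≃ ℤ where
  toFun a := if n % 2 = 0 then a + n / 2 else -(a + (n - 1) / 2) - 1
  invFun a := if n % 2 = 0 then a - n / 2 else -a - 1 - (n - 1) / 2
  left_inv a := by dsimp only; split_ifs <;> ring
  right_inv a := by dsimp only; split_ifs <;> ring

theorem T_hs (n a : ℤ) : T (hs n a) = T a + 2 * a * n + tri n := by
  have ht := two_tri n
  simp only [hs, Equiv.coe_fn_mk, T]
  rcases Int.even_or_odd' n with ⟨m, rfl | rfl⟩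
  · rw [if_pos (by omega), show 2 * m / 2 = m by omega]; linarith
  · rw [if_neg (by omega), show (2 * m + 1 - 1) / 2 = m by omega]; linarith

theorem psi_y : psi * ser ey cS = ser T fun a => a := by
  ext N
  unfold psi
  rw [coeff_shift (adm1 T_ge _) adm_ey (fun p => hs p.1)
    (fun a p => 1 * (p.1 ^ 2 + (1 - 2 * (-a)) * p.1 + 2 * p.1 * p.2)), coeff_ser]
  · refine finsum_congr fun a => ?_
    have := kern_two (d := 1) le_rfl (N - T a) (-a)
    unfold kern at this
    unfold cS
    rw [this]; unfold dl
    by_cases h : T a = N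
    · rw [if_pos h, if_pos (by omega)]; ring
    · rw [if_neg h, if_neg (by omega)]; ring
  · intro a p
    have ht := two_tri p.1
    simp only [T_hs, ey]; linarith

theorem vS_psi : vS * psi = jac := by
  unfold vS jac
  rw [ser_add (adm1 T_ge _) (adm1 T_ge _), ser_smul, ← psi_y]
  show _ = _ + psi
  ring

def rot : ℤ × ℤ ≃ ℤ × ℤ where
  toFun p := if p.1 % 2 = 0 then (p.2 + p.1 / 2, p.2 - p.1 / 2)
    else ((p.1 - 1) / 2 - p.2, (p.1 - 1) / 2 - p.2 - p.1)
  invFun p := (p.1 - p.2, if (p.1 - p.2) % 2 = 0 then (p.1 + p.2) / 2 else (-1 - p.1 - p.2) / 2)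
  left_inv p := by
    obtain ⟨w, c⟩ := p
    dsimp only
    split_ifs <;> ext <;> simp only <;> try split_ifs
    all_goals (try simp only at *) <;> omega
  right_inv p := by
    obtain ⟨w, c⟩ := p
    dsimp only
    split_ifs <;> ext <;> simp only <;> try split_ifs
    all_goals (try simp only at *) <;> omega

theorem rot_T (p : ℤ × ℤ) : T (rot p).1 + T (rot p).2 = p.1 ^ 2 + 2 * T p.2 := by
  obtain ⟨w, c⟩ := p
  simp only [rot, Equiv.coe_fn_mk, T]
  rcases Int.even_or_odd' w with ⟨m, rfl | rfl⟩
  · rw [if_pos (by omega), show 2 * m / 2 = m by omega]; ring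
  · rw [if_neg (by omega), show (2 * m + 1 - 1) / 2 = m by omega]; ring

theorem rot_c (p : ℤ × ℤ) : (4 * (rot p).1 + 1) + (4 * (rot p).2 + 1) =
    2 * (pm p.1 * (4 * p.2 + 1)) := by
  obtain ⟨w, c⟩ := p
  simp only [rot, Equiv.coe_fn_mk]
  rcases Int.even_or_odd' w with ⟨m, rfl | rfl⟩
  · rw [if_pos (by omega), show 2 * m / 2 = m by omega, pm_even (by omega)]; ring
  · rw [if_neg (by omega), show (2 * m + 1 - 1) / 2 = m by omega, pm_odd (by omega)]; ring

theorem ex_psi (d : ℕ) [NeZero d] : ex d psi = ser (fun a => d * T a) fun _ => 1 := ser_expand _ _ _ _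
theorem ex_phi (d : ℕ) [NeZero d] : ex d phi = ser (fun a => d * a ^ 2) fun _ => 1 := ser_expand _ _ _ _
theorem ex_phim (d : ℕ) [NeZero d] : ex d phim = ser (fun a => d * a ^ 2) pm := ser_expand _ _ _ _
theorem ex_jac (d : ℕ) [NeZero d] : ex d jac = ser (fun a => d * T a) fun a => 4 * a + 1 :=
  ser_expand _ _ _ _

theorem psi_sq : psi * psi = phi * ex 2 psi := by
  rw [ex_psi]
  unfold psi phi
  rw [ser_mul (adm1 T_ge _) (adm1 T_ge _), ser_mul (adm1 sq_ge _) ((adm1 T_ge _).dil 2 (by norm_num)),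
    ← ser_comp _ _ rot]
  congr 1
  funext p
  simpa using rot_T p

theorem jac_psi : jac * psi = phim * ex 2 jac := by
  have h1 : jac * psi = ser (fun p : ℤ × ℤ => T p.1 + T p.2) (fun p => 4 * p.1 + 1) := by
    unfold jac psi
    rw [ser_mul (adm1 T_ge _) (adm1 T_ge _)]; simp
  have h2 : jac * psi = ser (fun p : ℤ × ℤ => T p.1 + T p.2) (fun p => 4 * p.2 + 1) := by
    rw [mul_comm]
    unfold jac psi
    rw [ser_mul (adm1 T_ge _) (adm1 T_ge _)]; simp
  have ad : ∀ c, Adm (fun p : ℤ × ℤ => T p.1 + T p.2) c := fun c => by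
    refine adm2 fun p _ => ?_
    have a := T_ge p.1
    have b := T_ge p.2
    have := abs_nonneg p.1
    have := abs_nonneg p.2
    constructor <;> linarith
  have h3 : jac * psi + jac * psi = C 2 * (phim * ex 2 jac) := by
    nth_rw 1 [h1]
    rw [h2, ← ser_add (ad _) (ad _), ex_jac, phim, ser_mul (adm1 sq_ge _)
      ((adm1 T_ge _).dil 2 (by norm_num)), ← ser_smul, ← ser_comp _ _ rot]
    congr 1
    · funext p; simpa using rot_T p
    · funext p; simpa using rot_c p
  have h4 : C 2 * (jac * psi) = C 2 * (phim * ex 2 jac) := by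
    rw [← h3, ← two_mul]; congr 1
  exact mul_left_cancel₀ (by rw [Ne, map_eq_zero_iff _ C_injective]; norm_num) h4

theorem psi_c0 : constantCoeff psi = 1 := by
  rw [← coeff_zero_eq_constantCoeff_apply, psi, coeff_ser, finsum_eq_single _ 0]
  · simp [T]
  · intro a ha
    rw [if_neg]
    have := T_ge a
    have := abs_pos.2 ha
    push_cast; omega

theorem ne_of_c0 {F : ℤ⟦X⟧} (h : constantCoeff F = 1) : F ≠ 0 := by
  rintro rfl; simp at h

theorem ex_c0 {F : ℤ⟦X⟧} (d : ℕ) [NeZero d] (h : constantCoeff F = 1) : constantCoeff (ex d F) = 1 := by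
  rw [ex, constantCoeff_expand, h]

theorem v_phi : vS * phi = VS 1 * phim := by
  have h1 := psi_sq
  have h2 := jac_psi
  rw [← vS_psi, ex, map_mul] at h2
  change _ = phim * (ex 2 vS * ex 2 psi) at h2
  rw [ex2_vS] at h2
  refine mul_right_cancel₀ (ne_of_c0 (ex_c0 2 psi_c0)) ?_
  linear_combination h2 - vS * h1

theorem V_phi : VS 1 * ex 2 phi = VS 2 * ex 2 phim := by
  have := congrArg (ex 2) v_phi
  simp only [ex, map_mul] at this
  change ex 2 vS * ex 2 phi = ex 2 (VS 1) * ex 2 phim at this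
  rwa [ex2_vS, ex2_VS] at this

theorem coeffZ_VS (d : ℕ) (hd : d ≠ 0) (M : ℤ) : coeffZ (VS d) M = vhat d M := by
  have h : coeffZ (ser (eV d) cS) M = kern 4 1 d M := by
    rw [coeffZ_ser (adm_eV d hd)]
    unfold kern eV cS
    simp only [one_mul]
  unfold vhat
  rw [← h]
  unfold coeffZ VS dl
  split_ifs with h1 h2 h2
  · rw [map_add, coeff_C_mul, coeff_one, if_pos (by omega)]
  · rw [map_add, coeff_C_mul, coeff_one, if_neg (by omega)]
  · omega
  · simp

end RC

namespace RC
open PowerSeries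

def E0 (i : ℤ × ℤ) : ℤ := T i.1 + 2 * i.2 ^ 2

theorem E0_mod (i : ℤ × ℤ) : ∃ u, E0 i = 4 * u - i.1 + 2 * i.2 := by
  refine ⟨tri i.1 + tri (i.2 - 1), ?_⟩
  have h1 := two_tri i.1
  have h2 := two_tri (i.2 - 1)
  unfold E0 T
  linarith

theorem adm_E0 (c : ℤ × ℤ → ℤ) : Adm E0 c := by
  refine adm2 fun p _ => ?_
  have a := T_ge p.1
  have b := sq_ge p.2
  have := abs_nonneg p.1
  have := abs_nonneg p.2
  unfold E0
  constructor <;> linarith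

theorem E0_fin (N : ℕ) (f : ℤ × ℤ → ℤ) (h : ∀ i, (N : ℤ) < E0 i → f i = 0) :
    (Function.support f).Finite := by
  refine ((adm_E0 fun _ => 1).2 N).subset ?_
  intro i hi
  refine ⟨one_ne_zero, ?_⟩
  by_contra hc
  exact hi (h i (by omega))

noncomputable def Th : ℤ⟦X⟧ := psi * ex 2 phi

theorem Th_eq : Th = ser E0 fun _ => 1 := by
  unfold Th
  rw [ex_phi, psi, ser_mul (adm1 T_ge _) ((adm1 sq_ge _).dil 2 (by norm_num))]
  simp; rfl

theorem psim_phi : psim * ex 2 phi = ser E0 fun i => pm i.1 := by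
  rw [ex_phi, psim, ser_mul (adm1 T_ge _) ((adm1 sq_ge _).dil 2 (by norm_num))]
  simp; rfl

theorem psim_phim : psim * ex 2 phim = ser E0 fun i => pm (i.1 + i.2) := by
  rw [ex_phim, psim, ser_mul (adm1 T_ge _) ((adm1 sq_ge _).dil 2 (by norm_num))]
  simp only [pm_add]; rfl

noncomputable def sA (j : ℤ) : ℤ⟦X⟧ := ser (eA j) cN
noncomputable def sB : ℤ⟦X⟧ := ser eB cN

theorem kern_neg (r s d M : ℤ) : (∑ᶠ p : ℤ × ℤ,
    if d * (p.1 ^ 2 + s * p.1 + r * p.1 * p.2) = M then cN p else 0) = - kern r s d M := by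
  unfold kern
  rw [← finsum_neg_distrib]
  refine finsum_congr fun p => ?_
  unfold cN
  split_ifs <;> simp

theorem vhat_neg {d : ℕ} (hd : d ≠ 0) {M : ℤ} (h : M < 0) : vhat d M = 0 := by
  rw [← coeffZ_VS d hd, coeffZ, if_neg (by omega)]

theorem dl_of_ne {M : ℤ} (h : M ≠ 0) : dl M = 0 := by simp [dl, h]

theorem vhat_mod {M : ℤ} (h : M % 4 ≠ 0) : vhat 2 M = 0 := by
  unfold vhat kern
  rw [dl_of_ne (by rintro rfl; simp at h), finsum_eq_zero_of_forall_eq_zero]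
  · simp
  · intro p
    rw [if_neg]
    intro h1
    apply h
    have := two_tri p.1
    have h2 : M = 4 * (tri p.1 + 2 * p.1 * p.2) := by rw [← h1]; linarith
    omega

def hsa (n : ℤ) : ℤ × ℤ ≃ ℤ × ℤ := (hs n).prodCongr (Equiv.refl ℤ)
def hsb (n m : ℤ) : ℤ × ℤ ≃ ℤ × ℤ := (hs n).prodCongr (Equiv.addRight m)

theorem E0_hsa (n : ℤ) (i : ℤ × ℤ) : E0 (hsa n i) = E0 i + 2 * i.1 * n + tri n := by
  have : hsa n i = (hs n i.1, i.2) := rfl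
  rw [this]; simp only [E0, T_hs]; ring
theorem E0_hsb (n m : ℤ) (i : ℤ × ℤ) :
    E0 (hsb n m i) = E0 i + 2 * i.1 * n + tri n + 4 * i.2 * m + 2 * m ^ 2 := by
  have : hsb n m i = (hs n i.1, i.2 + m) := rfl
  rw [this]; simp only [E0, T_hs]; ring

theorem coeff_ThB (N : ℕ) : 4 * coeff N (Th * sB) =
    ∑ᶠ i : ℤ × ℤ, (- (pm i.1 * vhat 1 (N - E0 i)) + (2 * i.1 + 1) * dl (N - E0 i)) := by
  rw [Th_eq, sB, coeff_shift (adm_E0 _) adm_eB (fun p => hsa (-p.1))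
    (fun i p => 1 * (p.1 ^ 2 + (1 - 2 * i.1) * p.1 + 4 * p.1 * p.2)), _root_.mul_finsum]
  · refine finsum_congr fun i => ?_
    rw [kern_neg]
    linarith [kern_four (d := 1) le_rfl (N - E0 i) i.1]
  · intro i p
    have h1 := two_tri p.1
    have h2 := two_tri (-p.1)
    simp only [E0_hsa, eB]; linarith

theorem sum_zero {N : ℤ} {E : ℤ} (g : ℤ × ℤ → ℤ) (h : ∀ p, g p ≠ N - E) :
    (∑ᶠ p : ℤ × ℤ, if g p = N - E then cN p else 0) = 0 :=
  finsum_eq_zero_of_forall_eq_zero fun p => if_neg (h p)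

theorem coeff_A1_0 (N : ℕ) (hN : N % 4 = 0) : 4 * coeff N (Th * sA 1) =
    ∑ᶠ i : ℤ × ℤ, - ((i.1 + 2 * i.2) * dl (N - E0 i)) := by
  rw [Th_eq, sA, coeff_shift (adm_E0 _) (adm_eA 1 (by norm_num) le_rfl) (fun p => hsb p.1 p.1)
    (fun i p => 4 * p.1 ^ 2 + (2 * i.1 + 4 * i.2 + 4) * p.1 + 8 * p.1 * p.2), _root_.mul_finsum]
  · refine finsum_congr fun i => ?_
    obtain ⟨u, hu⟩ := E0_mod i
    obtain ⟨a, b⟩ := i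
    simp only at hu ⊢
    by_cases hc : (a + 2 * b) % 4 = 0
    · obtain ⟨l, hl⟩ := Int.dvd_of_emod_eq_zero hc
      have e : ∀ p : ℤ × ℤ, 4 * p.1 ^ 2 + (2 * a + 4 * b + 4) * p.1 + 8 * p.1 * p.2 =
          4 * (p.1 ^ 2 + (1 - 2 * (-l)) * p.1 + 2 * p.1 * p.2) := by
        intro p
        linear_combination 2 * p.1 * hl
      simp only [e]
      rw [kern_neg, kern_two (by norm_num), hl]; ring
    · rw [sum_zero, dl_of_ne]
      · simp
      · omega
      · rintro ⟨n, k⟩ h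
        simp only at h
        rcases Int.even_or_odd' a with ⟨α, rfl | rfl⟩
        · have : N - E0 (2 * α, b) = 4 * (n ^ 2 + α * n + b * n + n + 2 * n * k) := by
            rw [← h]; ring
          omega
        · have : N - E0 (2 * α + 1, b) = 2 * (2 * n ^ 2 + (2 * α + 1) * n + 2 * b * n + 2 * n + 4 * n * k) := by
            rw [← h]; ring
          omega
  · intro i p
    have h1 := two_tri p.1
    simp only [E0_hsb, eA]; linarith

theorem coeff_A0_0 (N : ℕ) (hN : N % 4 = 0) : 4 * coeff N (Th * sA 0) =
    ∑ᶠ i : ℤ × ℤ, (- (pm (i.1 + i.2) * vhat 2 (N - E0 i)) + (i.1 + 1) * dl (N - E0 i)) := by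
  rw [Th_eq, sA, coeff_shift (adm_E0 _) (adm_eA 0 le_rfl (by norm_num)) (fun p => hsa (-p.1))
    (fun i p => 2 * p.1 ^ 2 + (2 - 2 * i.1) * p.1 + 8 * p.1 * p.2), _root_.mul_finsum]
  · refine finsum_congr fun i => ?_
    obtain ⟨u, hu⟩ := E0_mod i
    obtain ⟨a, b⟩ := i
    simp only at hu ⊢
    by_cases hc : (a + 2 * b) % 4 = 0
    · obtain ⟨l, hl⟩ : ∃ l, a = 2 * l := ⟨a / 2, by omega⟩
      have e : ∀ p : ℤ × ℤ, 2 * p.1 ^ 2 + (2 - 2 * a) * p.1 + 8 * p.1 * p.2 =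
          2 * (p.1 ^ 2 + (1 - 2 * l) * p.1 + 4 * p.1 * p.2) := by
        intro p
        rw [hl]; ring
      simp only [e]
      have h1 := kern_four (d := 2) (by norm_num) (N - E0 (a, b)) l
      have h2 : pm l = pm (a + b) := pm_congr (by omega)
      rw [h2] at h1
      rw [kern_neg, hl] at *; linarith
    · rw [sum_zero, dl_of_ne, vhat_mod]
      · simp
      · omega
      · omega
      · rintro ⟨n, k⟩ h
        simp only at h
        have ht := two_tri n
        rcases Int.even_or_odd' a with ⟨α, rfl | rfl⟩
        · have : N - E0 (2 * α, b) = 4 * (tri n - α * n + 2 * n * k) := by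
            rw [← h]; linarith
          omega
        · have : N - E0 (2 * α + 1, b) = 2 * (n ^ 2 + n - (2 * α + 1) * n + 4 * n * k) := by
            rw [← h]; ring
          omega
  · intro i p
    have h1 := two_tri p.1
    have h2 := two_tri (-p.1)
    simp only [E0_hsa, eA]; linarith

theorem coeff_A0_1 (N : ℕ) (hN : N % 4 = 1) : 4 * coeff N (Th * sA 0) =
    ∑ᶠ i : ℤ × ℤ, ((i.1 - 2 * i.2 + 1) * dl (N - E0 i)) := by
  rw [Th_eq, sA, coeff_shift (adm_E0 _) (adm_eA 0 le_rfl (by norm_num)) (fun p => hsb (-p.1) p.1)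
    (fun i p => 4 * p.1 ^ 2 + (-2 * i.1 + 4 * i.2 + 2) * p.1 + 8 * p.1 * p.2), _root_.mul_finsum]
  · refine finsum_congr fun i => ?_
    obtain ⟨u, hu⟩ := E0_mod i
    obtain ⟨a, b⟩ := i
    simp only at hu ⊢
    by_cases hc : (a - 2 * b + 1) % 4 = 0
    · obtain ⟨l, hl⟩ := Int.dvd_of_emod_eq_zero hc
      have e : ∀ p : ℤ × ℤ, 4 * p.1 ^ 2 + (-2 * a + 4 * b + 2) * p.1 + 8 * p.1 * p.2 =
          4 * (p.1 ^ 2 + (1 - 2 * l) * p.1 + 2 * p.1 * p.2) := by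
        intro p
        linear_combination (-2) * p.1 * hl
      simp only [e]
      rw [kern_neg, kern_two (by norm_num), hl]; ring
    · rw [sum_zero, dl_of_ne]
      · simp
      · omega
      · rintro ⟨n, k⟩ h
        simp only at h
        rcases Int.even_or_odd' a with ⟨α, rfl | rfl⟩
        · have : N - E0 (2 * α, b) = 2 * (2 * n ^ 2 - 2 * α * n + 2 * b * n + n + 4 * n * k) := by
            rw [← h]; ring
          omega
        · have : N - E0 (2 * α + 1, b) = 4 * (n ^ 2 - α * n + b * n + 2 * n * k) := by
            rw [← h]; ring
          omega
  · intro i p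
    have h1 := two_tri p.1
    have h2 := two_tri (-p.1)
    simp only [E0_hsb, eA]; linarith

theorem coeff_A1_1 (N : ℕ) (hN : N % 4 = 1) : 4 * coeff N (Th * sA 1) =
    ∑ᶠ i : ℤ × ℤ, ((pm (i.1 + i.2) * vhat 2 (N - E0 i)) - i.1 * dl (N - E0 i)) := by
  rw [Th_eq, sA, coeff_shift (adm_E0 _) (adm_eA 1 (by norm_num) le_rfl) (fun p => hsa (p.1))
    (fun i p => 2 * p.1 ^ 2 + (2 * i.1 + 4) * p.1 + 8 * p.1 * p.2), _root_.mul_finsum]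
  · refine finsum_congr fun i => ?_
    obtain ⟨u, hu⟩ := E0_mod i
    obtain ⟨a, b⟩ := i
    simp only at hu ⊢
    by_cases hc : (a - 2 * b + 1) % 4 = 0
    · obtain ⟨l, hl⟩ : ∃ l, a = -2 * l - 1 := ⟨-((a + 1) / 2), by omega⟩
      have e : ∀ p : ℤ × ℤ, 2 * p.1 ^ 2 + (2 * a + 4) * p.1 + 8 * p.1 * p.2 =
          2 * (p.1 ^ 2 + (1 - 2 * l) * p.1 + 4 * p.1 * p.2) := by
        intro p
        rw [hl]; ring
      simp only [e]
      have h1 := kern_four (d := 2) (by norm_num) (N - E0 (a, b)) l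
      have h2 : pm l = - pm (a + b) := by
        have h3 : pm l = pm (a + b + 1) := pm_congr (by omega)
        rw [h3, pm_add _ 1]; simp [pm]
      rw [h2] at h1
      rw [kern_neg, hl] at *; linarith
    · rw [sum_zero, dl_of_ne, vhat_mod]
      · simp
      · omega
      · omega
      · rintro ⟨n, k⟩ h
        simp only at h
        have ht := two_tri n
        rcases Int.even_or_odd' a with ⟨α, rfl | rfl⟩
        · have : N - E0 (2 * α, b) = 2 * (n ^ 2 + 2 * α * n + 2 * n + 4 * n * k) := by
            rw [← h]; ring
          omega
        · have : N - E0 (2 * α + 1, b) = 4 * (tri n + α * n + n + 2 * n * k) := by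
            rw [← h]; linarith
          omega
  · intro i p
    have h1 := two_tri p.1
    simp only [E0_hsa, eA]; linarith

theorem sum_b (N : ℕ) : ∑ᶠ i : ℤ × ℤ, (2 * i.2) * dl (N - E0 i) = 0 := by
  have h := finsum_comp_equiv ((Equiv.refl ℤ).prodCongr (Equiv.neg ℤ))
    (f := fun i : ℤ × ℤ => (2 * i.2) * dl (N - E0 i))
  have h2 : ∀ i, (2 * (((Equiv.refl ℤ).prodCongr (Equiv.neg ℤ)) i).2) *
      dl (N - E0 (((Equiv.refl ℤ).prodCongr (Equiv.neg ℤ)) i)) = - ((2 * i.2) * dl (N - E0 i)) := by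
    intro i
    have : ((Equiv.refl ℤ).prodCongr (Equiv.neg ℤ)) i = (i.1, -i.2) := rfl
    rw [this]
    have : E0 (i.1, -i.2) = E0 i := by unfold E0; simp
    rw [this]; ring
  simp only [h2] at h
  rw [finsum_neg_distrib] at h
  linarith

theorem coeff_Th (N : ℕ) (hN : N % 4 = 0 ∨ N % 4 = 1) :
    coeff N (Th * (sA 0 - sA 1 - sB)) = 0 := by
  have f1 : ∀ c : ℤ × ℤ → ℤ, (Function.support fun i => c i * dl (N - E0 i)).Finite := fun c =>
    E0_fin N _ fun i hi => by rw [dl_of_ne (by omega), mul_zero]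
  have f2 : ∀ c : ℤ × ℤ → ℤ, (Function.support fun i => c i * vhat 2 (N - E0 i)).Finite := fun c =>
    E0_fin N _ fun i hi => by
      rw [show (2:ℤ) = ((2:ℕ):ℤ) by rfl, vhat_neg (by norm_num) (by omega), mul_zero]
  have f3 : ∀ c : ℤ × ℤ → ℤ, (Function.support fun i => c i * vhat 1 (N - E0 i)).Finite := fun c =>
    E0_fin N _ fun i hi => by
      rw [show (1:ℤ) = ((1:ℕ):ℤ) by rfl, vhat_neg (by norm_num) (by omega), mul_zero]
  have h1 : coeff N (ser E0 (fun i => pm i.1) * VS 1) = ∑ᶠ i : ℤ × ℤ, pm i.1 * vhat 1 (N - E0 i) := by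
    rw [coeff_ser_mul (adm_E0 _)]
    refine finsum_congr fun i => ?_
    rw [coeffZ_VS 1 (by norm_num)]; rfl
  have h2 : coeff N (ser E0 (fun i => pm (i.1 + i.2)) * VS 2) =
      ∑ᶠ i : ℤ × ℤ, pm (i.1 + i.2) * vhat 2 (N - E0 i) := by
    rw [coeff_ser_mul (adm_E0 _)]
    refine finsum_congr fun i => ?_
    rw [coeffZ_VS 2 (by norm_num)]; rfl
  have h3 : ser E0 (fun i => pm i.1) * VS 1 = ser E0 (fun i => pm (i.1 + i.2)) * VS 2 := by
    rw [← psim_phi, ← psim_phim]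
    linear_combination psim * V_phi
  have hB := coeff_ThB N
  simp only [← neg_mul] at hB
  rw [finsum_add_distrib (f3 _) (f1 _)] at hB
  simp only [neg_mul, finsum_neg_distrib] at hB
  rw [← h1, h3, h2] at hB
  have hb := sum_b N
  have key : 4 * coeff N (Th * sA 0) - 4 * coeff N (Th * sA 1) - 4 * coeff N (Th * sB) = 0 := by
    rw [hB]
    rcases hN with hN | hN
    · rw [coeff_A0_0 N hN, coeff_A1_0 N hN]
      simp only [← neg_mul]
      rw [finsum_add_distrib (f2 _) (f1 _)]
      simp only [neg_mul, finsum_neg_distrib]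
      have := finsum_add_distrib (f1 fun i => i.1 + 1) (f1 fun i => i.1 + 2 * i.2)
      have h5 := finsum_add_distrib (f1 fun i => 2 * i.1 + 1) (f1 fun i => 2 * i.2)
      have h6 : ∑ᶠ i : ℤ × ℤ, ((i.1 + 1) * dl (N - E0 i) + (i.1 + 2 * i.2) * dl (N - E0 i)) =
          ∑ᶠ i : ℤ × ℤ, ((2 * i.1 + 1) * dl (N - E0 i) + (2 * i.2) * dl (N - E0 i)) :=
        finsum_congr fun i => by ring
      linarith
    · rw [coeff_A0_1 N hN, coeff_A1_1 N hN]
      rw [finsum_sub_distrib (f2 _) (f1 _)]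
      have := finsum_add_distrib (f1 fun i => i.1 - 2 * i.2 + 1) (f1 fun i => i.1)
      have h5 := finsum_sub_distrib (f1 fun i => 2 * i.1 + 1) (f1 fun i => 2 * i.2)
      have h6 : ∑ᶠ i : ℤ × ℤ, ((i.1 - 2 * i.2 + 1) * dl (N - E0 i) + (i.1) * dl (N - E0 i)) =
          ∑ᶠ i : ℤ × ℤ, ((2 * i.1 + 1) * dl (N - E0 i) - (2 * i.2) * dl (N - E0 i)) :=
        finsum_congr fun i => by ring
      linarith
  rw [mul_sub, mul_sub, map_sub, map_sub]
  linarith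

end RC

namespace RC
open PowerSeries
open scoped Classical

variable {ι κ : Type}

noncomputable def ind (A : ι → Prop) (i : ι) : ℤ := if A i then 1 else 0

theorem ser_ind (e : ι → ℤ) (A : ι → Prop) (N : ℕ) :
    coeff N (ser e (ind A)) = ∑ᶠ (i) (_ : i ∈ {i | A i ∧ e i = N}), (1 : ℤ) := by
  rw [coeff_ser]
  refine finsum_congr fun i => ?_
  rw [finsum_eq_if]
  unfold ind
  by_cases h1 : A i <;> by_cases h2 : e i = N <;> simp [h1, h2]

theorem ser_bij {A : ι → Prop} {B : κ → Prop} {e₁ : ι → ℤ} {e₂ : κ → ℤ} (f : ι → κ) (g : κ → ι)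
    (hf : ∀ i, A i → B (f i)) (hg : ∀ j, B j → A (g j)) (gf : ∀ i, A i → g (f i) = i)
    (fg : ∀ j, B j → f (g j) = j) (he : ∀ i, A i → e₂ (f i) = e₁ i) :
    ser e₁ (ind A) = ser e₂ (ind B) := by
  ext N
  rw [ser_ind, ser_ind]
  refine finsum_mem_eq_of_bijOn f ?_ (fun _ _ => rfl)
  refine ⟨?_, ?_, ?_⟩
  · rintro i ⟨h1, h2⟩
    exact ⟨hf i h1, by rw [he i h1, h2]⟩
  · rintro i ⟨h1, _⟩ j ⟨h2, _⟩ h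
    rw [← gf i h1, h, gf j h2]
  · rintro j ⟨h1, h2⟩
    exact ⟨g j, ⟨hg j h1, by rw [← he _ (hg j h1), fg j h1, h2]⟩, fg j h1⟩

theorem X_ser (d : ℕ) {e c : ι → ℤ} (h : Adm e c) : X ^ d * ser e c = ser (fun i => d + e i) c := by
  ext N
  rw [coeff_X_pow_mul', coeff_ser]
  split_ifs with hd
  · rw [coeff_ser]
    refine finsum_congr fun i => ?_
    by_cases h1 : e i = ((N - d : ℕ) : ℤ)
    · rw [if_pos h1, if_pos (by omega)]
    · rw [if_neg h1, if_neg (by omega)]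
  · symm
    refine finsum_eq_zero_of_forall_eq_zero fun i => ?_
    split_ifs with h1
    · by_contra h2
      have h3 := h.1 i h2
      have h4 : (d : ℤ) + e i = N := by simpa using h1
      omega
    · rfl

abbrev MS := Multiset ℕ
noncomputable def es (s : MS) : ℤ := (s.sum : ℤ)
noncomputable def gq (Q : MS → Prop) : ℤ⟦X⟧ := ser es (ind fun s => 0 ∉ s ∧ Q s)

theorem fin_ms (N : ℤ) : {s : MS | 0 ∉ s ∧ es s ≤ N}.Finite := by
  have : {s : MS | 0 ∉ s ∧ es s ≤ N} ⊆
      ⋃ n ∈ Finset.range (N.toNat + 1), Set.range (fun π : n.Partition => π.parts) := by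
    rintro s ⟨h1, h2⟩
    unfold es at h2
    simp only [Set.mem_iUnion]
    refine ⟨s.sum, by simp; omega, ⟨⟨s, ?_, rfl⟩, rfl⟩⟩
    intro i hi
    exact Nat.pos_of_ne_zero (by rintro rfl; exact h1 hi)
  refine Set.Finite.subset ?_ this
  exact Set.Finite.biUnion (Finset.finite_toSet _) fun n _ => Set.finite_range _

theorem adm_gq (Q : MS → Prop) : Adm es (ind fun s => 0 ∉ s ∧ Q s) := by
  refine ⟨fun s _ => by unfold es; positivity, fun N => (fin_ms N).subset ?_⟩
  rintro s ⟨h1, h2⟩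
  refine ⟨?_, h2⟩
  by_contra h
  apply h1
  simp [ind, h]

theorem coeff_gq (Q : MS → Prop) (n : ℕ) :
    coeff n (gq Q) = ((Finset.univ.filter fun π : n.Partition => Q π.parts).card : ℤ) := by
  unfold gq
  rw [ser_ind]
  have : ((Finset.univ.filter fun π : n.Partition => Q π.parts).card : ℤ) =
      ∑ᶠ (π) (_ : π ∈ {π : n.Partition | Q π.parts}), (1 : ℤ) := by
    rw [finsum_mem_eq_sum_filter _ _ (Set.toFinite _)]
    simp only [Finset.sum_const, nsmul_eq_mul, mul_one]
    congr 2
    ext π; simp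
  rw [this]
  symm
  refine finsum_mem_eq_of_bijOn (fun π => π.parts) ⟨?_, ?_, ?_⟩ (fun _ _ => rfl)
  · intro π h
    refine ⟨⟨fun h0 => lt_irrefl _ (π.parts_pos h0), h⟩, ?_⟩
    simp [es, π.parts_sum]
  · intro a _ b _ h
    exact Nat.Partition.ext h
  · rintro s ⟨⟨h0, h1⟩, h2⟩
    refine ⟨⟨s, ?_, ?_⟩, h1, rfl⟩
    · intro i hi
      exact Nat.pos_of_ne_zero (by rintro rfl; exact h0 hi)
    · unfold es at h2; exact_mod_cast h2

theorem gq_congr {Q R : MS → Prop} (h : ∀ s, 0 ∉ s → (Q s ↔ R s)) : gq Q = gq R := by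
  unfold gq
  congr 1
  funext s
  unfold ind
  by_cases h0 : 0 ∈ s
  · simp [h0]
  · simp [h0, h s h0]

theorem gq_split (Q R : MS → Prop) : gq Q = gq (fun s => Q s ∧ R s) + gq (fun s => Q s ∧ ¬ R s) := by
  unfold gq
  rw [← ser_add (adm_gq _) (adm_gq _)]
  congr 1
  funext s
  unfold ind
  by_cases h0 : 0 ∈ s <;> by_cases h1 : Q s <;> by_cases h2 : R s <;> simp [h0, h1, h2]

theorem gq_zero {Q : MS → Prop} (h : ∀ s, 0 ∉ s → ¬ Q s) : gq Q = 0 := by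
  ext n
  rw [coeff_gq, Finset.card_eq_zero.2]
  · simp
  · rw [Finset.filter_eq_empty_iff]
    intro π _
    exact h _ fun h0 => lt_irrefl _ (π.parts_pos h0)

theorem gq_dvd {Q : MS → Prop} {d : ℕ} (h : ∀ s, 0 ∉ s → Q s → d ≤ s.sum) : X ^ d ∣ gq Q := by
  rw [X_pow_dvd_iff]
  intro n hn
  rw [coeff_gq, Finset.card_eq_zero.2]
  · simp
  · rw [Finset.filter_eq_empty_iff]
    intro π _ hQ
    have := h _ (fun h0 => lt_irrefl _ (π.parts_pos h0)) hQ
    rw [π.parts_sum] at this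
    omega

theorem gq_lsum (Q : MS → Prop) (st : MS → ℕ) (h : ∀ s, 0 ∉ s → Q s → st s ≤ s.sum) :
    gq Q = lsum fun ν => gq fun s => Q s ∧ st s = ν := by
  have hd : ∀ ν, X ^ ν ∣ gq fun s => Q s ∧ st s = ν := fun ν =>
    gq_dvd (by rintro s h0 ⟨h1, rfl⟩; exact h s h0 h1)
  refine lsum_eq hd fun M => ?_
  have key : ∀ M, gq Q - ∑ ν ∈ Finset.range M, (gq fun s => Q s ∧ st s = ν) =
      gq fun s => Q s ∧ M ≤ st s := by
    intro M
    induction M with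
    | zero => simp
    | succ M ih =>
      rw [Finset.sum_range_succ, ← sub_sub, ih, gq_split (fun s => Q s ∧ M ≤ st s) (fun s => st s = M)]
      have e1 : (gq fun s => (Q s ∧ M ≤ st s) ∧ st s = M) = gq fun s => Q s ∧ st s = M :=
        gq_congr fun s _ => by constructor <;> (rintro h; grind)
      have e2 : (gq fun s => (Q s ∧ M ≤ st s) ∧ ¬ st s = M) = gq fun s => Q s ∧ M + 1 ≤ st s :=
        gq_congr fun s _ => by constructor <;> (rintro h; grind)
      rw [e1, e2]; ring
  rw [key]
  exact gq_dvd fun s h0 h1 => h1.2.trans (h s h0 h1.1)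

theorem gq_bij {Q R : MS → Prop} (d : ℕ) (f g : MS → MS)
    (hf : ∀ s, 0 ∉ s → Q s → 0 ∉ f s ∧ R (f s)) (hg : ∀ s, 0 ∉ s → R s → 0 ∉ g s ∧ Q (g s))
    (gf : ∀ s, 0 ∉ s → Q s → g (f s) = s) (fg : ∀ s, 0 ∉ s → R s → f (g s) = s)
    (hsum : ∀ s, 0 ∉ s → Q s → (f s).sum = d + s.sum) : gq R = X ^ d * gq Q := by
  unfold gq
  rw [X_ser d (adm_gq _)]
  symm
  refine ser_bij f g (fun s h => hf s h.1 h.2) (fun s h => hg s h.1 h.2) (fun s h => gf s h.1 h.2)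
    (fun s h => fg s h.1 h.2) ?_
  intro s h
  unfold es
  rw [hsum s h.1 h.2]; push_cast; rfl

theorem gq_mul (Q R S : MS → Prop) (p : ℕ → Prop) [DecidablePred p] (h1 : ∀ s, 0 ∉ s → Q s → ∀ x ∈ s, p x)
    (h2 : ∀ s, 0 ∉ s → R s → ∀ x ∈ s, ¬ p x)
    (h3 : ∀ s, 0 ∉ s → (S s ↔ Q (s.filter p) ∧ R (s.filter fun x => ¬ p x))) :
    gq S = gq Q * gq R := by
  unfold gq
  rw [ser_mul (adm_gq _) (adm_gq _)]
  have : (fun q : MS × MS => (ind (fun s => 0 ∉ s ∧ Q s) q.1) * (ind (fun s => 0 ∉ s ∧ R s) q.2)) =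
      ind (fun q : MS × MS => (0 ∉ q.1 ∧ Q q.1) ∧ (0 ∉ q.2 ∧ R q.2)) := by
    funext q
    unfold ind
    by_cases h1 : (0 ∉ q.1 ∧ Q q.1) <;> by_cases h2 : (0 ∉ q.2 ∧ R q.2) <;> simp [h1, h2]
  rw [this]
  refine ser_bij (fun s => (s.filter p, s.filter fun x => ¬ p x)) (fun q => q.1 + q.2) ?_ ?_ ?_ ?_ ?_
  · rintro s ⟨h0, hS⟩
    have := (h3 s h0).1 hS
    exact ⟨⟨fun h => h0 (Multiset.mem_of_mem_filter h), this.1⟩,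
      ⟨fun h => h0 (Multiset.mem_of_mem_filter h), this.2⟩⟩
  all_goals try
    rintro ⟨a, b⟩ ⟨⟨ha, hQ⟩, ⟨hb, hR⟩⟩
    have e1 : (a + b).filter p = a := by
      rw [Multiset.filter_add, Multiset.filter_eq_self.2 (h1 a ha hQ),
        Multiset.filter_eq_nil.2 (h2 b hb hR), add_zero]
    have e2 : (a + b).filter (fun x => ¬ p x) = b := by
      rw [Multiset.filter_add, Multiset.filter_eq_self.2 (h2 b hb hR),
        Multiset.filter_eq_nil.2 (by simpa using h1 a ha hQ), zero_add]
  · have h0 : 0 ∉ a + b := by simp at ha hb ⊢; exact ⟨ha, hb⟩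
    exact ⟨h0, (h3 _ h0).2 (by rw [e1, e2]; exact ⟨hQ, hR⟩)⟩
  · rintro s _
    exact Multiset.filter_add_not _ _
  · simp only [e1, e2]
  · rintro s _
    unfold es
    simp only
    rw [← Nat.cast_add, ← Multiset.sum_add, Multiset.filter_add_not]

end RC

namespace RC
open PowerSeries
open scoped Classical

noncomputable def PP : ℤ⟦X⟧ := gq fun _ => True
noncomputable def eP (ν : ℕ) : ℤ⟦X⟧ := gq fun s => ∀ x ∈ s, x ≤ ν

theorem gq_empty : gq (fun s => s = 0) = 1 := by
  ext n
  unfold gq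
  rw [coeff_ser, finsum_eq_single _ (0 : MS)]
  · rw [coeff_one]
    by_cases h : n = 0
    · subst h; simp [es, ind]
    · have : ¬ (es 0 = (n : ℤ)) := by simp [es]; omega
      rw [if_neg this, if_neg h]
  · intro s hs
    simp [ind, hs]

theorem one_sub_ne (k : ℕ) : (1 - X ^ (k + 1) : ℤ⟦X⟧) ≠ 0 := ne_of_c0 (by simp)

theorem eP_zero : eP 0 = 1 := by
  rw [← gq_empty]
  refine gq_congr fun s h0 => ?_
  constructor
  · intro h
    refine Multiset.eq_zero_of_forall_notMem fun x hx => ?_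
    have := h x hx
    have : x = 0 := by omega
    exact h0 (this ▸ hx)
  · rintro rfl; simp

theorem gq_cons {Q R : MS → Prop} {a : ℕ} (ha : 0 < a) (h : ∀ s, 0 ∉ s → (Q s ↔ R (a ::ₘ s))) :
    (gq fun s => R s ∧ a ∈ s) = X ^ a * gq Q := by
  refine gq_bij a (fun s => a ::ₘ s) (fun s => s.erase a) ?_ ?_ ?_ ?_ ?_
  · intro s h0 hQ
    refine ⟨?_, (h s h0).1 hQ, by simp⟩
    simp only [Multiset.mem_cons, not_or]
    exact ⟨by omega, h0⟩
  · rintro s h0 ⟨hR, ha⟩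
    have h1 : 0 ∉ s.erase a := fun hh => h0 (Multiset.mem_of_mem_erase hh)
    exact ⟨h1, (h _ h1).2 (by rwa [Multiset.cons_erase ha])⟩
  · intro s _ _; simp
  · rintro s _ ⟨_, ha⟩; exact Multiset.cons_erase ha
  · intro s _ _; simp

theorem eP_succ (ν : ℕ) : (1 - X ^ (ν + 1)) * eP (ν + 1) = eP ν := by
  have h : eP (ν + 1) = X ^ (ν + 1) * eP (ν + 1) + eP ν := by
    conv_lhs => rw [eP, gq_split _ (fun s => (ν + 1) ∈ s)]
    congr 1
    · refine gq_cons (by omega) fun s _ => ?_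
      simp
    · refine gq_congr fun s _ => ?_
      constructor
      · rintro ⟨h1, h2⟩ x hx
        have := h1 x hx
        have : x ≠ ν + 1 := by rintro rfl; exact h2 hx
        omega
      · intro h
        exact ⟨fun x hx => (h x hx).trans (by omega), fun hx => by have := h _ hx; omega⟩
  linear_combination h

theorem PP_eP (ν : ℕ) : X ^ (ν + 1) ∣ PP - eP ν := by
  have h : PP = eP ν + gq (fun s => True ∧ ¬ ∀ x ∈ s, x ≤ ν) := by
    conv_lhs => rw [PP, gq_split _ (fun s => ∀ x ∈ s, x ≤ ν)]
    congr 1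
    exact gq_congr fun s _ => by simp
  rw [h, add_sub_cancel_left]
  refine gq_dvd fun s _ hs => ?_
  obtain ⟨_, hs⟩ := hs
  push Not at hs
  obtain ⟨x, hx, hlt⟩ := hs
  exact (Nat.succ_le_of_lt hlt).trans (Multiset.le_sum_of_mem hx)

noncomputable def low (ν : ℕ) : ℤ⟦X⟧ := gq fun s => ∀ x ∈ s, 2 ≤ x ∧ x ≤ ν

theorem low_eq (ν : ℕ) (hν : 1 ≤ ν) : low ν = (1 - X) * eP ν := by
  have h : eP ν = X ^ 1 * eP ν + low ν := by
    conv_lhs => rw [eP, gq_split _ (fun s => 1 ∈ s)]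
    congr 1
    · refine gq_cons (by omega) fun s _ => ?_
      simp; omega
    · refine gq_congr fun s h0 => ?_
      constructor
      · rintro ⟨h1, h2⟩ x hx
        have := h1 x hx
        have : x ≠ 1 := by rintro rfl; exact h2 hx
        have : x ≠ 0 := by rintro rfl; exact h0 hx
        omega
      · intro h
        exact ⟨fun x hx => (h x hx).2, fun hx => by have := h _ hx; omega⟩
  linear_combination -h

noncomputable def high (k ν : ℕ) : ℤ⟦X⟧ := gq fun s => s.card = k ∧ ∀ x ∈ s, ν < x

theorem high_shift (k ν : ℕ) : high k (ν + 1) = X ^ k * high k ν := by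
  refine gq_bij k (fun s => s.map (· + 1)) (fun s => s.map (· - 1)) ?_ ?_ ?_ ?_ ?_
  · rintro s h0 ⟨h1, h2⟩
    refine ⟨by simp, by simpa using h1, ?_⟩
    simpa using h2
  · rintro s h0 ⟨h1, h2⟩
    refine ⟨?_, by simpa using h1, ?_⟩
    · simp only [Multiset.mem_map, not_exists, not_and]
      intro x hx; have := h2 x hx; omega
    · intro x hx
      obtain ⟨y, hy, rfl⟩ := Multiset.mem_map.1 hx
      have := h2 y hy; omega
  · intro s _ _; simp
  · rintro s h0 ⟨h1, h2⟩
    rw [Multiset.map_map]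
    conv_rhs => rw [← Multiset.map_id s]
    refine Multiset.map_congr rfl fun x hx => ?_
    have := h2 x hx
    simp only [Function.comp, id]; omega
  · rintro s _ ⟨h1, _⟩
    simp [Multiset.sum_map_add, h1, add_comm]

theorem high_split (k ν : ℕ) : high (k + 1) ν = X ^ (ν + 1) * high k ν + high (k + 1) (ν + 1) := by
  conv_lhs => rw [high, gq_split _ (fun s => (ν + 1) ∈ s)]
  congr 1
  · refine gq_cons (by omega) fun s _ => ?_
    simp
  · refine gq_congr fun s _ => ?_
    constructor
    · rintro ⟨⟨h1, h2⟩, h3⟩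
      refine ⟨h1, fun x hx => ?_⟩
      have := h2 x hx
      have : x ≠ ν + 1 := by rintro rfl; exact h3 hx
      omega
    · rintro ⟨h1, h2⟩
      exact ⟨⟨h1, fun x hx => by have := h2 x hx; omega⟩, fun hx => by have := h2 _ hx; omega⟩

theorem high_eq (k ν : ℕ) : high k ν = X ^ (k * (ν + 1)) * eP k := by
  induction k with
  | zero =>
    rw [eP_zero, ← gq_empty]
    simp only [zero_mul, pow_zero, one_mul]
    refine gq_congr fun s _ => ?_
    constructor
    · rintro ⟨h, _⟩; exact Multiset.card_eq_zero.1 h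
    · rintro rfl; simp
  | succ k ih =>
    have h1 := high_split k ν
    have h2 := high_shift (k + 1) ν
    have h3 := eP_succ k
    refine mul_left_cancel₀ (one_sub_ne k) ?_
    rw [h2, ih] at h1
    linear_combination h1 - X ^ ((k + 1) * (ν + 1)) * h3

theorem gq_ones (ν k : ℕ) (hν : 1 ≤ ν) :
    (gq fun s => s.count 1 = ν ∧ (s.filter fun x => ν < x).card = k) =
      X ^ ν * (low ν * high k ν) := by
  have h1 : (gq fun s => 1 ∉ s ∧ (s.filter fun x => ν < x).card = k) = low ν * high k ν := by
    refine gq_mul _ _ _ (fun x => x ≤ ν) ?_ ?_ ?_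
    · intro s _ h x hx; exact (h x hx).2
    · intro s _ h x hx; exact not_le.2 (h.2 x hx)
    · intro s h0
      simp only [not_le]
      constructor
      · rintro ⟨h1, h2⟩
        refine ⟨fun x hx => ?_, h2, fun x hx => (Multiset.mem_filter.1 hx).2⟩
        obtain ⟨hx1, hx2⟩ := Multiset.mem_filter.1 hx
        have : x ≠ 1 := by rintro rfl; exact h1 hx1
        have : x ≠ 0 := by rintro rfl; exact h0 hx1
        omega
      · rintro ⟨h1, h2, _⟩
        refine ⟨fun h => ?_, h2⟩
        have := h1 1 (Multiset.mem_filter.2 ⟨h, hν⟩)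
        omega
  rw [← h1]
  refine gq_bij ν (fun s => s + Multiset.replicate ν 1) (fun s => s.filter (· ≠ 1)) ?_ ?_ ?_ ?_ ?_
  · rintro s h0 ⟨h1, h2⟩
    refine ⟨?_, ?_, ?_⟩
    · simp [Multiset.mem_replicate, h0]
    · simp [Multiset.count_eq_zero.2 h1]
    · rw [Multiset.filter_add, Multiset.card_add, h2]
      rw [Multiset.filter_eq_nil.2]
      · simp
      · intro x hx; rw [Multiset.eq_of_mem_replicate hx]; omega
  · rintro s h0 ⟨h1, h2⟩
    refine ⟨fun h => h0 (Multiset.mem_of_mem_filter h), by simp, ?_⟩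
    rw [Multiset.filter_filter, ← h2]
    congr 1
    refine Multiset.filter_congr fun x _ => ?_
    constructor
    · rintro ⟨h, _⟩; exact h
    · intro h; exact ⟨h, by omega⟩
  · rintro s h0 ⟨h1, h2⟩
    rw [Multiset.filter_add, Multiset.filter_eq_self.2, Multiset.filter_eq_nil.2, add_zero]
    · intro x hx; rw [Multiset.eq_of_mem_replicate hx]; simp
    · rintro x hx rfl; exact h1 hx
  · rintro s h0 ⟨h1, h2⟩
    rw [← h1, ← Multiset.filter_eq']
    rw [add_comm]
    exact Multiset.filter_add_not _ _
  · rintro s h0 ⟨h1, h2⟩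
    simp [add_comm]

theorem sup_le_sum (s : MS) : s.sup ≤ s.sum := by
  refine Multiset.sup_le.2 fun x hx => Multiset.le_sum_of_mem hx

theorem sup_mem {s : MS} (h : s ≠ 0) : s.sup ∈ s := by
  induction s using Multiset.induction_on with
  | empty => exact absurd rfl h
  | cons a s ih =>
    rw [Multiset.sup_cons]
    by_cases hs : s = 0
    · subst hs; simp
    · rcases le_total a s.sup with h1 | h1
      · rw [sup_eq_right.2 h1]; exact Multiset.mem_cons_of_mem (ih hs)
      · rw [sup_eq_left.2 h1]; simp

theorem gq_noones (m : ℕ) (hm : 2 ≤ m) :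
    (gq fun s => s.count 1 = 0 ∧ s.sup = m) = X ^ m * low m := by
  have : (gq fun s => s.count 1 = 0 ∧ s.sup = m) = gq fun s => (s.count 1 = 0 ∧ s.sup = m) ∧ m ∈ s := by
    refine gq_congr fun s _ => ⟨fun h => ⟨h, ?_⟩, fun h => h.1⟩
    rw [← h.2]
    refine sup_mem ?_
    rintro rfl
    have := h.2
    simp at this
    omega
  rw [this]
  refine gq_cons (by omega) fun s h0 => ?_
  rw [Multiset.sup_cons, sup_eq_left, Multiset.sup_le, Multiset.count_eq_zero, Multiset.mem_cons, not_or]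
  constructor
  · intro h
    exact ⟨⟨by omega, fun h1 => by have := h 1 h1; omega⟩, fun x hx => (h x hx).2⟩
  · rintro ⟨⟨_, h1⟩, h2⟩ x hx
    have : x ≠ 1 := by rintro rfl; exact h1 hx
    have : x ≠ 0 := by rintro rfl; exact h0 hx
    have := h2 x hx
    omega

end RC

namespace RC
open PowerSeries
open scoped Classical

theorem zero_of_rec {δ : ℕ → ℤ⟦X⟧} (h : ∀ m, ∃ m', X * δ m' ∣ δ m) (m : ℕ) : δ m = 0 := by
  apply eq_zero_of_dvd
  intro M
  induction M generalizing m with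
  | zero => simp
  | succ M ih =>
    obtain ⟨m', h'⟩ := h m
    refine dvd_trans ?_ h'
    rw [pow_succ']
    exact mul_dvd_mul_left _ (ih m')

noncomputable def dt (s m ν : ℕ) : ℤ⟦X⟧ := X ^ (ν ^ 2 + s * ν) * (eP ν * eP (ν + m))
noncomputable def Dd (s m : ℕ) : ℤ⟦X⟧ := lsum (dt s m)

theorem dt_dvd (s m ν : ℕ) : X ^ ν ∣ dt s m ν := by
  refine Dvd.dvd.mul_right (pow_dvd_pow _ ?_) _
  nlinarith [Nat.zero_le (s * ν), Nat.le_self_pow (two_ne_zero) ν]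

theorem Dd_R1 (s m : ℕ) : Dd s m - Dd (s + 1) m = X ^ (s + 1) * Dd (s + 2) (m + 1) := by
  unfold Dd
  rw [← lsum_sub, ← lsum_mul (dt_dvd _ _), lsum_succ (fun ν => dvd_sub (dt_dvd _ _ _) (dt_dvd _ _ _))]
  have h0 : dt s m 0 - dt (s + 1) m 0 = 0 := by simp [dt]
  rw [h0, zero_add]
  congr 1
  funext j
  have h := eP_succ j
  unfold dt
  rw [show j + 1 + m = j + (m + 1) by ring]
  linear_combination X ^ ((j + 1) ^ 2 + s * (j + 1)) * eP (j + (m + 1)) * h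

theorem Dd_R2 (s m : ℕ) : Dd s m = Dd s (m + 1) - X ^ (m + 1) * Dd (s + 1) (m + 1) := by
  unfold Dd
  rw [← lsum_mul (dt_dvd _ _), ← lsum_sub]
  congr 1
  funext j
  have h := eP_succ (j + m)
  unfold dt
  rw [show j + (m + 1) = j + m + 1 by ring]
  linear_combination (-X ^ (j ^ 2 + s * j)) * eP j * h

theorem Dd_same (m : ℕ) : Dd m m = Dd (m + 1) (m + 1) := by
  have := zero_of_rec (δ := fun m => Dd m m - Dd (m + 1) (m + 1)) (fun m => ⟨m + 1, ?_⟩) m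
  · exact sub_eq_zero.1 this
  · refine ⟨- X ^ m, ?_⟩
    have h1 := Dd_R2 m m
    have h2 := Dd_R1 m (m + 1)
    linear_combination h1 + h2

theorem Dd_dvd (M : ℕ) : X ^ (M + 1) ∣ Dd M M - PP := by
  have h1 : Dd M M = eP M + X ^ (M + 1) * lsum (fun j => X ^ (j ^ 2 + (M + 2) * j) * (eP (j + 1) * eP (j + 1 + M))) := by
    rw [← lsum_mul, Dd, lsum_succ (dt_dvd _ _)]
    · congr 1
      · simp [dt, eP_zero]
      · congr 1
        funext j
        unfold dt
        ring
    · intro ν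
      refine Dvd.dvd.mul_right (pow_dvd_pow _ ?_) _
      nlinarith [Nat.zero_le ((M + 2) * ν), Nat.le_self_pow (two_ne_zero) ν]
  have h2 := PP_eP M
  rw [h1]
  have : ∀ a b c : ℤ⟦X⟧, a + b - c = b - (c - a) := by intros; ring
  rw [this]
  exact dvd_sub (Dvd.intro _ rfl) h2

theorem Dd_PP (m : ℕ) : Dd m m = PP := by
  have h : ∀ j, Dd m m = Dd (m + j) (m + j) := by
    intro j
    induction j with
    | zero => rfl
    | succ j ih => rw [ih]; exact Dd_same _
  rw [← sub_eq_zero]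
  apply eq_zero_of_dvd
  intro M
  rw [h M]
  exact (pow_dvd_pow _ (by omega)).trans (Dd_dvd (m + M))

theorem D1_rec (m : ℕ) : Dd (m + 1) m = PP - X ^ (m + 1) * Dd (m + 2) (m + 1) := by
  have := Dd_R2 (m + 1) m
  rwa [Dd_PP] at this

theorem D2_eq (m : ℕ) : (1 - X) * Dd (m + 2) m = Dd (m + 1) m - X * Dd (m + 2) (m + 1) := by
  have := zero_of_rec (δ := fun m => (1 - X) * Dd (m + 2) m - (Dd (m + 1) m - X * Dd (m + 2) (m + 1)))
    (fun m => ⟨m + 1, ?_⟩) m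
  · exact sub_eq_zero.1 this
  · refine ⟨- X ^ (m + 1), ?_⟩
    have h1 := Dd_R1 (m + 1) m
    have h2 := D1_rec m
    have h3 := D1_rec (m + 1)
    linear_combination (-(1 - X)) * h1 - X * h2 + X * h3

def tn (i : ℕ) : ℕ := i * (i + 1) / 2
theorem two_tn (i : ℕ) : 2 * tn i = i * (i + 1) := by
  unfold tn
  exact Nat.mul_div_cancel' (Nat.even_mul_succ_self i).two_dvd
theorem tn_succ (i : ℕ) : tn (i + 1) = tn i + i + 1 := by
  have h1 := two_tn i
  have h2 := two_tn (i + 1)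
  nlinarith
theorem tn_zero : tn 0 = 0 := rfl

noncomputable def kt (m i : ℕ) : ℤ⟦X⟧ := C (pm i) * X ^ (tn i + m * (i + 1))
noncomputable def kk (m : ℕ) : ℤ⟦X⟧ := lsum (kt m)
noncomputable def ht (m i : ℕ) : ℤ⟦X⟧ := C (pm i) * X ^ (tn i + (i + 1) ^ 2 + m * (i + 1))
noncomputable def hh (m : ℕ) : ℤ⟦X⟧ := lsum (ht m)

theorem tn_ge (i : ℕ) : i ≤ tn i := by
  have := two_tn i
  rcases Nat.eq_zero_or_pos i with h | h
  · omega
  · nlinarith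
theorem kt_dvd (m i : ℕ) : X ^ i ∣ kt m i :=
  Dvd.dvd.mul_left (pow_dvd_pow _ (by have := tn_ge i; omega)) _
theorem ht_dvd (m i : ℕ) : X ^ i ∣ ht m i :=
  Dvd.dvd.mul_left (pow_dvd_pow _ (by have := tn_ge i; omega)) _

theorem pm_succ (i : ℕ) : pm ((i + 1 : ℕ) : ℤ) = - pm i := by
  push_cast; rw [pm_add]; simp [pm]

theorem kk_rec (m : ℕ) : kk m = X ^ m * (1 - kk (m + 1)) := by
  have h : kk m = X ^ m - X ^ m * kk (m + 1) := by
    unfold kk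
    rw [lsum_succ (kt_dvd m), ← lsum_mul (kt_dvd _), sub_eq_add_neg]
    congr 1
    · simp [kt, tn, pm]
    · rw [← zero_sub, eq_sub_iff_add_eq, ← lsum_add]
      ext N
      rw [lsum, coeff_mk]
      simp only [map_zero]
      refine Finset.sum_eq_zero fun j _ => ?_
      have : kt m (j + 1) + X ^ m * kt (m + 1) j = 0 := by
        unfold kt
        rw [pm_succ, tn_succ, map_neg]
        rw [show tn j + j + 1 + m * (j + 1 + 1) = m + (tn j + (m + 1) * (j + 1)) by ring]
        ring
      rw [this]; simp
  rw [h]; ring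

theorem hh_rec (m : ℕ) : hh m = X ^ (m + 1) * (1 - hh (m + 3)) := by
  have h : hh m = X ^ (m + 1) - X ^ (m + 1) * hh (m + 3) := by
    unfold hh
    rw [lsum_succ (ht_dvd m), ← lsum_mul (ht_dvd _), sub_eq_add_neg]
    congr 1
    · simp [ht, tn, pm, add_comm]
    · rw [← zero_sub, eq_sub_iff_add_eq, ← lsum_add]
      ext N
      rw [lsum, coeff_mk]
      simp only [map_zero]
      refine Finset.sum_eq_zero fun j _ => ?_
      have : ht m (j + 1) + X ^ (m + 1) * ht (m + 3) j = 0 := by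
        unfold ht
        rw [pm_succ, tn_succ, map_neg]
        rw [show tn j + j + 1 + (j + 1 + 1) ^ 2 + m * (j + 1 + 1) =
          (m + 1) + (tn j + (j + 1) ^ 2 + (m + 3) * (j + 1)) by ring]
        ring
      rw [this]; simp
  rw [h]; ring

theorem D1_kk (m : ℕ) : X ^ (m + 1) * Dd (m + 2) (m + 1) = PP * kk (m + 1) := by
  have := zero_of_rec (δ := fun m => X ^ (m + 1) * Dd (m + 2) (m + 1) - PP * kk (m + 1))
    (fun m => ⟨m + 1, ?_⟩) m
  · exact sub_eq_zero.1 this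
  · refine ⟨- X ^ m, ?_⟩
    have h1 := D1_rec (m + 1)
    have h2 := kk_rec (m + 1)
    linear_combination X ^ (m + 1) * h1 - PP * h2

theorem D2_kk (m : ℕ) : (1 - X) * X ^ (m + 1) * Dd (m + 3) (m + 1) = PP * (kk (m + 1) - kk (m + 2)) := by
  have h1 := D2_eq (m + 1)
  have h2 := D1_kk m
  have h3 := D1_kk (m + 1)
  linear_combination X ^ (m + 1) * h1 + h2 - h3

noncomputable def crk (s : MS) : ℤ := if s.count 1 = 0 then (s.sup : ℤ)
  else ((s.filter (fun x => s.count 1 < x)).card : ℤ) - s.count 1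

theorem card_le_sum {s : MS} (h : 0 ∉ s) : s.card ≤ s.sum := by
  have := Multiset.card_nsmul_le_sum (s := s) (a := 1) (fun x hx =>
    Nat.pos_of_ne_zero (by rintro rfl; exact h hx))
  simpa using this

theorem lsum_drop {f : ℕ → ℤ⟦X⟧} (hf : ∀ ν, X ^ ν ∣ f ν) (m : ℕ) (h : ∀ ν < m, f ν = 0) :
    lsum f = lsum fun j => f (j + m) := by
  induction m with
  | zero => rfl
  | succ m ih =>
    rw [ih (fun ν hν => h ν (by omega)), lsum_succ]
    · simp only [zero_add]
      rw [h m (by omega), zero_add]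
      congr 1; funext j; congr 1; ring
    · intro ν; exact (pow_dvd_pow _ (by omega)).trans (hf _)

theorem count_le {s : MS} (h : 0 ∉ s) : s.count 1 ≤ s.sum :=
  (Multiset.count_le_card 1 s).trans (card_le_sum h)

theorem crk_pos (m : ℕ) (hm : 2 ≤ m) : (gq fun s => crk s = m) = (1 - X) * X ^ m * Dd (m + 2) m := by
  rw [gq_lsum _ (fun s => s.count 1) (fun s h0 _ => count_le h0), Dd, ← lsum_mul (dt_dvd _ _)]
  congr 1
  funext ν
  rcases Nat.eq_zero_or_pos ν with rfl | hν
  · have : (gq fun s => crk s = m ∧ s.count 1 = 0) = gq fun s => s.count 1 = 0 ∧ s.sup = m := by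
      refine gq_congr fun s _ => ?_
      constructor
      · rintro ⟨h1, h2⟩
        rw [crk, if_pos h2] at h1
        exact ⟨h2, by exact_mod_cast h1⟩
      · rintro ⟨h1, h2⟩
        exact ⟨by rw [crk, if_pos h1, h2], h1⟩
    rw [this, gq_noones m hm, low_eq m (by omega)]
    simp [dt, eP_zero]; ring
  · have : (gq fun s => crk s = m ∧ s.count 1 = ν) = gq fun s => s.count 1 = ν ∧
        (s.filter fun x => ν < x).card = ν + m := by
      refine gq_congr fun s _ => ?_
      constructor
      · rintro ⟨h1, h2⟩
        rw [crk, if_neg (by omega), h2] at h1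
        exact ⟨h2, by omega⟩
      · rintro ⟨h1, h2⟩
        exact ⟨by rw [crk, if_neg (by omega), h1, h2]; push_cast; ring, h1⟩
    rw [this, gq_ones ν _ hν, low_eq ν hν, high_eq, dt]
    ring

theorem crk_neg (m : ℕ) (hm : 2 ≤ m) :
    (gq fun s => crk s = -(m : ℤ)) = (1 - X) * X ^ m * Dd (m + 2) m := by
  rw [gq_lsum _ (fun s => s.count 1) (fun s h0 _ => count_le h0), Dd, ← lsum_mul (dt_dvd _ _),
    lsum_drop _ m]
  · congr 1
    funext ν
    have : (gq fun s => crk s = -(m : ℤ) ∧ s.count 1 = ν + m) = gq fun s => s.count 1 = ν + m ∧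
        (s.filter fun x => ν + m < x).card = ν := by
      refine gq_congr fun s _ => ?_
      constructor
      · rintro ⟨h1, h2⟩
        rw [crk, if_neg (by omega), h2] at h1
        exact ⟨h2, by omega⟩
      · rintro ⟨h1, h2⟩
        exact ⟨by rw [crk, if_neg (by omega), h1, h2]; push_cast; ring, h1⟩
    rw [this, gq_ones _ _ (by omega), low_eq _ (by omega), high_eq, dt]
    ring
  · intro ν hν
    refine gq_zero ?_
    rintro s _ ⟨h1, h2⟩
    unfold crk at h1
    split_ifs at h1 <;> omega
  · intro ν
    refine gq_dvd ?_
    rintro s h0 ⟨_, rfl⟩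
    exact count_le h0

theorem crk_kk (m : ℕ) (hm : 2 ≤ m) : (1 - X) * X ^ m * Dd (m + 2) m = PP * (kk m - kk (m + 1)) := by
  obtain ⟨j, rfl⟩ : ∃ j, m = j + 1 := ⟨m - 1, by omega⟩
  exact D2_kk j

theorem kk_dvd (m : ℕ) : X ^ m ∣ kk m := by rw [kk_rec]; exact Dvd.intro _ rfl
theorem hh_dvd (m : ℕ) : X ^ m ∣ hh m := by
  rw [hh_rec]; exact Dvd.dvd.mul_right (pow_dvd_pow _ (by omega)) _

theorem crk_abs {s : MS} (h : 0 ∉ s) : (crk s).natAbs ≤ s.sum := by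
  have h1 := sup_le_sum s
  have h2 := count_le h
  have h3 := card_le_sum h
  have h4 := Multiset.card_le_card (Multiset.filter_le (fun x => s.count 1 < x) s)
  unfold crk
  split_ifs <;> omega

theorem crank_series : (gq fun s => crk s % 8 = 2) =
    PP * lsum fun t => kk (2 + 4 * t) - kk (3 + 4 * t) := by
  rw [← lsum_mul (fun t => dvd_sub ((pow_dvd_pow _ (by omega)).trans (kk_dvd _))
    ((pow_dvd_pow _ (by omega)).trans (kk_dvd _))),
    gq_lsum _ (fun s => ((crk s).natAbs - 2) / 4) (fun s h _ => by have := crk_abs h; omega)]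
  congr 1
  funext t
  rw [show 3 + 4 * t = 2 + 4 * t + 1 by ring, ← crk_kk _ (by omega)]
  rcases Nat.even_or_odd' t with ⟨u, rfl | rfl⟩
  · rw [← crk_pos _ (by omega)]
    exact gq_congr fun s _ => by omega
  · rw [← crk_neg _ (by omega)]
    exact gq_congr fun s _ => by omega

end RC

namespace RC
open PowerSeries
open scoped Classical

noncomputable def rk (s : MS) : ℤ := (s.sup : ℤ) - s.card

noncomputable def dyf (r : ℤ) (s : MS) : MS :=
  (((s.card : ℤ) + r).toNat ::ₘ s.map (fun x => x - 1)).filter (fun x => 0 < x)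

noncomputable def dyg (r : ℤ) (s : MS) : MS :=
  (s.erase s.sup).map (fun x => x + 1) +
    Multiset.replicate (((s.sup : ℤ) - r).toNat - (s.erase s.sup).card) 1

theorem sum_filter_pos (s : MS) : (s.filter (fun x => 0 < x)).sum = s.sum := by
  induction s using Multiset.induction_on with
  | empty => simp
  | cons a s ih =>
    rcases Nat.eq_zero_or_pos a with rfl | h
    · simp [ih]
    · simp [h, ih]

theorem sum_map_pred {s : MS} (h : 0 ∉ s) : (s.map (fun x => x - 1)).sum + s.card = s.sum := by
  induction s using Multiset.induction_on with
  | empty => simp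
  | cons a s ih =>
    simp only [Multiset.mem_cons, not_or] at h
    have := ih h.2
    simp; omega

theorem pred_succ_ones {s : MS} (h : 0 ∉ s) :
    ((s.map (fun x => x - 1)).filter (fun x => 0 < x)).map (fun x => x + 1) +
      Multiset.replicate (s.card - ((s.map (fun x => x - 1)).filter (fun x => 0 < x)).card) 1 = s := by
  induction s using Multiset.induction_on with
  | empty => simp
  | cons a s ih =>
    simp only [Multiset.mem_cons, not_or] at h
    have h1 := ih h.2
    have h2 : ((s.map (fun x => x - 1)).filter (fun x => 0 < x)).card ≤ s.card := by
      simpa using Multiset.card_le_card (Multiset.filter_le (fun x => 0 < x) (s.map (fun x => x - 1)))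
    by_cases ha : a = 1
    · subst ha
      rw [Multiset.map_cons, Multiset.filter_cons_of_neg _ (by simp), Multiset.card_cons,
        Nat.succ_sub h2, Multiset.replicate_succ, Multiset.add_cons, h1]
    · rw [Multiset.map_cons, Multiset.filter_cons_of_pos _ (by omega), Multiset.card_cons,
        Multiset.card_cons, Nat.add_sub_add_right, Multiset.map_cons, Multiset.cons_add, h1]
      congr 1; omega

theorem le_sup' {s : MS} {x : ℕ} (h : x ∈ s) : x ≤ s.sup := Multiset.le_sup h

theorem dyf_a {r : ℤ} (hr : 2 ≤ r ∨ r ≤ -2) {s : MS} (h0 : 0 ∉ s) (h : rk s ≤ r + 1) :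
    0 ≤ (s.card : ℤ) + r := by
  unfold rk at h
  rcases hr with hr | hr
  · omega
  · have : s ≠ 0 := by rintro rfl; simp at h; omega
    have h1 := sup_mem this
    have : s.sup ≠ 0 := fun h2 => h0 (h2 ▸ h1)
    omega

theorem dyf_eq {r : ℤ} (hr : 2 ≤ r ∨ r ≤ -2) {s : MS} (h0 : 0 ∉ s) (h : rk s ≤ r + 1) :
    (dyf r s).sup = ((s.card : ℤ) + r).toNat ∧
    (dyf r s).erase (dyf r s).sup = (s.map (fun x => x - 1)).filter (fun x => 0 < x) := by
  have ha := dyf_a hr h0 h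
  have hle : ∀ x ∈ (s.map (fun x => x - 1)).filter (fun x => 0 < x), x ≤ ((s.card : ℤ) + r).toNat ∧ 0 < x := by
    intro x hx
    rw [Multiset.mem_filter, Multiset.mem_map] at hx
    obtain ⟨⟨y, hy, rfl⟩, hx⟩ := hx
    have := le_sup' hy
    unfold rk at h
    omega
  have hs : (dyf r s).sup = ((s.card : ℤ) + r).toNat := by
    unfold dyf
    rcases Nat.eq_zero_or_pos ((s.card : ℤ) + r).toNat with h1 | h1
    · rw [Multiset.filter_cons_of_neg _ (by omega)]
      apply le_antisymm
      · exact Multiset.sup_le.2 fun b hb => (hle b hb).1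
      · omega
    · rw [Multiset.filter_cons_of_pos _ (by exact h1), Multiset.sup_cons]
      exact sup_eq_left.2 (Multiset.sup_le.2 fun b hb => (hle b hb).1)
  refine ⟨hs, ?_⟩
  rw [hs]
  unfold dyf
  rcases Nat.eq_zero_or_pos ((s.card : ℤ) + r).toNat with h1 | h1
  · rw [Multiset.filter_cons_of_neg _ (by omega)]
    refine Multiset.erase_of_notMem fun h2 => ?_
    have := hle _ h2
    omega
  · rw [Multiset.filter_cons_of_pos _ (by exact h1), Multiset.erase_cons_head]

theorem dyf_zero (r : ℤ) (s : MS) : 0 ∉ dyf r s := by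
  unfold dyf; rw [Multiset.mem_filter]; rintro ⟨_, h⟩; exact lt_irrefl _ h

theorem dyf_rk {r : ℤ} (hr : 2 ≤ r ∨ r ≤ -2) {s : MS} (h0 : 0 ∉ s) (h : rk s ≤ r + 1) :
    r - 1 ≤ rk (dyf r s) := by
  have ha := dyf_a hr h0 h
  have h1 := (dyf_eq hr h0 h).1
  have h2 : (dyf r s).card ≤ s.card + 1 := by
    unfold dyf
    simpa using Multiset.card_le_card (Multiset.filter_le (fun x => 0 < x)
      (((s.card : ℤ) + r).toNat ::ₘ s.map (fun x => x - 1)))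
  unfold rk
  rw [h1]; omega

theorem dyf_sum {r : ℤ} (hr : 2 ≤ r ∨ r ≤ -2) {s : MS} (h0 : 0 ∉ s) (h : rk s ≤ r + 1) :
    ((dyf r s).sum : ℤ) = s.sum + r := by
  have ha := dyf_a hr h0 h
  have h1 := sum_map_pred h0
  unfold dyf
  rw [sum_filter_pos, Multiset.sum_cons]
  push_cast [← h1]
  omega

theorem dygf {r : ℤ} (hr : 2 ≤ r ∨ r ≤ -2) {s : MS} (h0 : 0 ∉ s) (h : rk s ≤ r + 1) :
    dyg r (dyf r s) = s := by
  have ha := dyf_a hr h0 h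
  obtain ⟨h1, h2⟩ := dyf_eq hr h0 h
  unfold dyg
  rw [h2, h1]
  have : ((((((s.card : ℤ) + r).toNat : ℕ) : ℤ) - r).toNat) = s.card := by omega
  rw [this]
  exact pred_succ_ones h0

theorem dyg_l {r : ℤ} (hr : 2 ≤ r ∨ r ≤ -2) {s : MS} (h : r - 1 ≤ rk s) :
    (((s.erase s.sup).card : ℤ) ≤ (s.sup : ℤ) - r) := by
  unfold rk at h
  by_cases h1 : s = 0
  · subst h1
    simp at h ⊢; omega
  · have h2 := Multiset.card_erase_add_one (sup_mem h1)
    omega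

theorem dyg_card {r : ℤ} (hr : 2 ≤ r ∨ r ≤ -2) {s : MS} (h : r - 1 ≤ rk s) :
    ((dyg r s).card : ℤ) = (s.sup : ℤ) - r := by
  have := dyg_l hr h
  unfold dyg
  simp only [Multiset.card_add, Multiset.card_map, Multiset.card_replicate]
  omega

theorem dyg_zero (r : ℤ) (s : MS) : 0 ∉ dyg r s := by
  unfold dyg
  rw [Multiset.mem_add, Multiset.mem_map]
  rintro (⟨x, _, h⟩ | h)
  · omega
  · have := Multiset.eq_of_mem_replicate h; omega

theorem dyg_rk {r : ℤ} (hr : 2 ≤ r ∨ r ≤ -2) {s : MS} (h : r - 1 ≤ rk s) :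
    rk (dyg r s) ≤ r + 1 := by
  have h1 := dyg_card hr h
  have h2 : (dyg r s).sup ≤ s.sup + 1 := by
    refine Multiset.sup_le.2 fun b hb => ?_
    unfold dyg at hb
    rw [Multiset.mem_add, Multiset.mem_map] at hb
    rcases hb with ⟨x, hx, rfl⟩ | hb
    · have := le_sup' (Multiset.mem_of_mem_erase hx); omega
    · have := Multiset.eq_of_mem_replicate hb; omega
  unfold rk
  rw [h1]; omega

theorem dyfg {r : ℤ} (hr : 2 ≤ r ∨ r ≤ -2) {s : MS} (h0 : 0 ∉ s) (h : r - 1 ≤ rk s) :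
    dyf r (dyg r s) = s := by
  have h1 := dyg_card hr h
  unfold dyf
  rw [h1, show ((s.sup : ℤ) - r + r).toNat = s.sup by omega]
  unfold dyg
  rw [Multiset.map_add, Multiset.map_map, Multiset.map_replicate]
  have : (s.erase s.sup).map ((fun x => x - 1) ∘ (fun x => x + 1)) = s.erase s.sup := by
    conv_rhs => rw [← Multiset.map_id (s.erase s.sup)]
    exact Multiset.map_congr rfl fun x _ => by simp
  rw [this, ← Multiset.cons_add, Multiset.filter_add]
  have e2 : ∀ k, (Multiset.replicate k (1 - 1)).filter (fun x => 0 < x) = 0 := by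
    intro k
    refine Multiset.filter_eq_nil.2 fun a ha => ?_
    have := Multiset.eq_of_mem_replicate ha; omega
  rw [e2, add_zero]
  by_cases hs : s = 0
  · subst hs; simp
  · rw [Multiset.cons_erase (sup_mem hs)]
    exact Multiset.filter_eq_self.2 fun a ha => Nat.pos_of_ne_zero (by rintro rfl; exact h0 ha)

theorem gq_compl (Q : MS → Prop) : (gq fun s => ¬ Q s) = PP - gq Q := by
  have h := gq_split (fun _ => True) Q
  unfold PP
  rw [h]
  simp

theorem H_rec (m : ℕ) (hm : 1 ≤ m) : (gq fun s => (m : ℤ) ≤ rk s) =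
    X ^ (m + 1) * (PP - gq fun s => ((m + 3 : ℕ) : ℤ) ≤ rk s) := by
  rw [← gq_compl]
  have hr : 2 ≤ ((m : ℤ) + 1) ∨ ((m : ℤ) + 1) ≤ -2 := by left; omega
  have key : ∀ s, (¬ ((m + 3 : ℕ) : ℤ) ≤ rk s) → rk s ≤ (m : ℤ) + 1 + 1 := by intro s h; omega
  refine gq_bij (m + 1) (dyf (m + 1)) (dyg (m + 1)) ?_ ?_ ?_ ?_ ?_
  · intro s h0 h
    have := dyf_rk hr h0 (key s h)
    exact ⟨dyf_zero _ _, by omega⟩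
  · intro s h0 h
    have := dyg_rk hr (s := s) (by omega)
    exact ⟨dyg_zero _ _, by omega⟩
  · intro s h0 h; exact dygf hr h0 (key s h)
  · intro s h0 h; exact dyfg hr h0 (by omega)
  · intro s h0 h
    have := dyf_sum hr h0 (key s h)
    omega

theorem G_rec (m : ℕ) (hm : 1 ≤ m) : (gq fun s => rk s ≤ -(m : ℤ)) =
    X ^ (m + 1) * (PP - gq fun s => rk s ≤ -((m + 3 : ℕ) : ℤ)) := by
  rw [← gq_compl]
  have hr : 2 ≤ (-(m : ℤ) - 1) ∨ (-(m : ℤ) - 1) ≤ -2 := by right; omega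
  have key : ∀ s, (¬ rk s ≤ -((m + 3 : ℕ) : ℤ)) → (-(m : ℤ) - 1) - 1 ≤ rk s := by intro s h; omega
  refine gq_bij (m + 1) (dyg (-(m : ℤ) - 1)) (dyf (-(m : ℤ) - 1)) ?_ ?_ ?_ ?_ ?_
  · intro s h0 h
    have := dyg_rk hr (s := s) (key s h)
    exact ⟨dyg_zero _ _, by omega⟩
  · intro s h0 h
    have := dyf_rk hr h0 (by omega)
    exact ⟨dyf_zero _ _, by omega⟩
  · intro s h0 h; exact dyfg hr h0 (key s h)
  · intro s h0 h; exact dygf hr h0 (by omega)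
  · intro s h0 h
    have h1 := dyf_sum hr (dyg_zero _ _) (dyg_rk hr (key s h))
    rw [dyfg hr h0 (key s h)] at h1
    omega

theorem H_hh (m : ℕ) : (gq fun s => ((m + 1 : ℕ) : ℤ) ≤ rk s) = PP * hh (m + 1) := by
  have := zero_of_rec (δ := fun m : ℕ => (gq fun s => ((m + 1 : ℕ) : ℤ) ≤ rk s) - PP * hh (m + 1))
    (fun m => ⟨m + 3, ?_⟩) m
  · exact sub_eq_zero.1 this
  · refine ⟨- X ^ (m + 1), ?_⟩
    have h1 := H_rec (m + 1) (by omega)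
    have h2 := hh_rec (m + 1)
    rw [show m + 1 + 3 = m + 3 + 1 by ring] at h1 h2
    linear_combination h1 - PP * h2

theorem G_hh (m : ℕ) : (gq fun s => rk s ≤ -((m + 1 : ℕ) : ℤ)) = PP * hh (m + 1) := by
  have := zero_of_rec (δ := fun m : ℕ => (gq fun s => rk s ≤ -((m + 1 : ℕ) : ℤ)) - PP * hh (m + 1))
    (fun m => ⟨m + 3, ?_⟩) m
  · exact sub_eq_zero.1 this
  · refine ⟨- X ^ (m + 1), ?_⟩
    have h1 := G_rec (m + 1) (by omega)
    have h2 := hh_rec (m + 1)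
    rw [show m + 1 + 3 = m + 3 + 1 by ring] at h1 h2
    linear_combination h1 - PP * h2

theorem rk_pos (m : ℕ) (hm : 1 ≤ m) : (gq fun s => rk s = m) = PP * (hh m - hh (m + 1)) := by
  obtain ⟨j, rfl⟩ : ∃ j, m = j + 1 := ⟨m - 1, by omega⟩
  rw [mul_sub, ← H_hh j, ← H_hh (j + 1),
    gq_split (fun s => ((j + 1 : ℕ) : ℤ) ≤ rk s) (fun s => rk s = ((j + 1 : ℕ) : ℤ))]
  have e1 : (gq fun s => ((j + 1 : ℕ) : ℤ) ≤ rk s ∧ rk s = ((j + 1 : ℕ) : ℤ)) =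
    gq fun s => rk s = ((j + 1 : ℕ) : ℤ) := gq_congr fun s _ => by omega
  have e2 : (gq fun s => ((j + 1 : ℕ) : ℤ) ≤ rk s ∧ ¬ rk s = ((j + 1 : ℕ) : ℤ)) =
    gq fun s => ((j + 1 + 1 : ℕ) : ℤ) ≤ rk s := gq_congr fun s _ => by omega
  rw [e1, e2]; ring

theorem rk_neg (m : ℕ) (hm : 1 ≤ m) : (gq fun s => rk s = -(m : ℤ)) = PP * (hh m - hh (m + 1)) := by
  obtain ⟨j, rfl⟩ : ∃ j, m = j + 1 := ⟨m - 1, by omega⟩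
  rw [mul_sub, ← G_hh j, ← G_hh (j + 1),
    gq_split (fun s => rk s ≤ -((j + 1 : ℕ) : ℤ)) (fun s => rk s = -((j + 1 : ℕ) : ℤ))]
  have e1 : (gq fun s => rk s ≤ -((j + 1 : ℕ) : ℤ) ∧ rk s = -((j + 1 : ℕ) : ℤ)) =
    gq fun s => rk s = -((j + 1 : ℕ) : ℤ) := gq_congr fun s _ => by omega
  have e2 : (gq fun s => rk s ≤ -((j + 1 : ℕ) : ℤ) ∧ ¬ rk s = -((j + 1 : ℕ) : ℤ)) =
    gq fun s => rk s ≤ -((j + 1 + 1 : ℕ) : ℤ) := gq_congr fun s _ => by omega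
  rw [e1, e2]; ring

theorem rk_abs {s : MS} (h : 0 ∉ s) : (rk s).natAbs ≤ s.sum := by
  have h1 := sup_le_sum s
  have h3 := card_le_sum h
  unfold rk
  omega

theorem hh_dvd' (m t : ℕ) (h : t ≤ m) : X ^ t ∣ hh m := (pow_dvd_pow _ h).trans (hh_dvd _)
theorem kk_dvd' (m t : ℕ) (h : t ≤ m) : X ^ t ∣ kk m := (pow_dvd_pow _ h).trans (kk_dvd _)

theorem rank_series : (gq fun s => rk s % 8 = 3) =
    PP * lsum fun t => (hh (3 + 8 * t) - hh (4 + 8 * t)) + (hh (5 + 8 * t) - hh (6 + 8 * t)) := by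
  rw [← lsum_mul (fun t => dvd_add (dvd_sub (hh_dvd' _ _ (by omega)) (hh_dvd' _ _ (by omega)))
      (dvd_sub (hh_dvd' _ _ (by omega)) (hh_dvd' _ _ (by omega)))),
    gq_lsum _ (fun s => (rk s).natAbs / 8) (fun s h _ => by have := rk_abs h; omega)]
  congr 1
  funext t
  rw [gq_split _ (fun s => 0 ≤ rk s), mul_add]
  congr 1
  · rw [show 4 + 8 * t = 3 + 8 * t + 1 by ring, ← rk_pos _ (by omega)]
    exact gq_congr fun s _ => by omega
  · rw [show 6 + 8 * t = 5 + 8 * t + 1 by ring, ← rk_neg _ (by omega)]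
    exact gq_congr fun s _ => by omega

end RC

namespace RC
open PowerSeries
open scoped Classical

variable {ι κ : Type}

theorem split_ser {f g : ι → κ} (hf : Function.Injective f) (hg : Function.Injective g)
    (hd : ∀ i j, f i ≠ g j) {e c : κ → ℤ} (h : Adm e c)
    (hc : ∀ p, c p ≠ 0 → (∃ i, f i = p) ∨ ∃ i, g i = p) :
    ser e c = ser (e ∘ f) (c ∘ f) + ser (e ∘ g) (c ∘ g) := by
  ext N
  rw [map_add, coeff_ser, coeff_ser, coeff_ser]
  have hfin := h.fin N
  set F : κ → ℤ := fun i => if e i = (N : ℤ) then c i else 0 with hF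
  have h1 : ∑ᶠ i, F i = ∑ᶠ i ∈ Set.range f ∪ Set.range g, F i := by
    rw [← finsum_mem_univ F]
    refine finsum_mem_inter_support_eq' F _ _ ?_
    intro p hp
    simp only [Set.mem_univ, true_iff, Set.mem_union, Set.mem_range]
    refine hc p ?_
    intro h0; apply hp; simp [hF, h0]
  have h2 : ∑ᶠ i ∈ Set.range f ∪ Set.range g, F i =
      (∑ᶠ i ∈ Set.range f, F i) + ∑ᶠ i ∈ Set.range g, F i := by
    refine finsum_mem_union' ?_ (hfin.subset Set.inter_subset_right) (hfin.subset Set.inter_subset_right)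
    rw [Set.disjoint_left]
    rintro _ ⟨i, rfl⟩ ⟨j, hj⟩
    exact hd i j hj.symm
  rw [h1, h2, finsum_mem_range hf, finsum_mem_range hg]
  rfl

theorem ser_lsum (e : ℕ → ℕ) (c : ℕ → ℤ) (h : ∀ ν, ν ≤ e ν) :
    ser (fun i => (e i : ℤ)) c = lsum fun i => C (c i) * X ^ (e i) := by
  ext N
  rw [coeff_ser, lsum, coeff_mk, finsum_eq_sum_of_support_subset (s := Finset.range (N + 1))]
  · refine Finset.sum_congr rfl fun i _ => ?_
    rw [coeff_C_mul, coeff_X_pow]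
    by_cases h1 : e i = N
    · simp [h1]
    · rw [if_neg (by exact_mod_cast h1), if_neg (Ne.symm h1)]; simp
  · intro i hi
    have h1 : e i = N := by
      by_contra h1
      exact hi (if_neg (by exact_mod_cast h1))
    have := h i
    simp; omega

theorem ser_lsum2 (e : ℕ × ℕ → ℕ) (c : ℕ × ℕ → ℤ) (h : ∀ i t, i ≤ e (i, t) ∧ t ≤ e (i, t)) :
    ser (fun p => (e p : ℤ)) c = lsum fun t => lsum fun i => C (c (i, t)) * X ^ (e (i, t)) := by
  ext N
  rw [coeff_ser, lsum, coeff_mk,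
    finsum_eq_sum_of_support_subset (s := Finset.range (N + 1) ×ˢ Finset.range (N + 1)),
    Finset.sum_product_right]
  · refine Finset.sum_congr rfl fun t _ => ?_
    rw [lsum, coeff_mk]
    refine Finset.sum_congr rfl fun i _ => ?_
    rw [coeff_C_mul, coeff_X_pow]
    by_cases h1 : e (i, t) = N
    · simp [h1]
    · rw [if_neg (by exact_mod_cast h1), if_neg (Ne.symm h1)]; simp
  · rintro ⟨i, t⟩ hi
    have h1 : e (i, t) = N := by
      by_contra h1
      exact hi (if_neg (by exact_mod_cast h1))
    have := h i t
    simp; omega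

theorem lsum_neg (f : ℕ → ℤ⟦X⟧) : lsum (fun ν => - f ν) = - lsum f := by
  ext N; simp [lsum]

def fp (p : ℕ × ℕ) : ℤ × ℤ := ((p.1 : ℤ) + 1, (p.2 : ℤ))
def fm (p : ℕ × ℕ) : ℤ × ℤ := (-((p.1 : ℤ) + 1), -((p.2 : ℤ) + 1))

theorem cN_fp (p : ℕ × ℕ) : cN (fp p) = pm p.1 := by
  have := pm_succ p.1
  push_cast at this
  have h2 : sg ((p.1 : ℤ) + 1) p.2 = 1 := by unfold sg; rw [if_pos (by omega)]
  simp only [cN, fp, this, h2]; ring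
theorem cN_fm (p : ℕ × ℕ) : cN (fm p) = - pm p.1 := by
  have := pm_succ p.1
  push_cast at this
  have h2 : sg (-((p.1 : ℤ) + 1)) (-((p.2 : ℤ) + 1)) = -1 := by
    unfold sg; rw [if_neg (by omega), if_pos (by omega)]
  simp only [cN, fm, pm_neg, this, h2]; ring

theorem ser_cN {e : ℤ × ℤ → ℤ} (h : Adm e cN) (ep em : ℕ × ℕ → ℕ)
    (hp : ∀ i t, i ≤ ep (i, t) ∧ t ≤ ep (i, t)) (hm : ∀ i t, i ≤ em (i, t) ∧ t ≤ em (i, t))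
    (h1 : ∀ p, e (fp p) = ep p) (h2 : ∀ p, e (fm p) = em p) :
    ser e cN = lsum fun t => (lsum fun i => C (pm i) * X ^ (ep (i, t))) -
      lsum fun i => C (pm i) * X ^ (em (i, t)) := by
  have hfp : Function.Injective fp := by
    rintro ⟨a, b⟩ ⟨c, d⟩ h; simp only [fp, Prod.mk.injEq] at h ⊢; omega
  have hfm : Function.Injective fm := by
    rintro ⟨a, b⟩ ⟨c, d⟩ h; simp only [fm, Prod.mk.injEq] at h ⊢; omega
  rw [split_ser hfp hfm (by
      rintro ⟨a, b⟩ ⟨c, d⟩ h; simp only [fp, fm, Prod.mk.injEq] at h; omega) h (by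
      rintro ⟨a, b⟩ h
      rcases cN_ne h with ⟨h1, h2⟩ | ⟨h1, h2⟩ <;> simp only at h1 h2
      · left; exact ⟨((a - 1).toNat, b.toNat), by simp only [fp, Prod.mk.injEq]; omega⟩
      · right; exact ⟨((-a - 1).toNat, (-b - 1).toNat), by simp only [fm, Prod.mk.injEq]; omega⟩)]
  have e1 : e ∘ fp = fun p => (ep p : ℤ) := funext h1
  have e2 : e ∘ fm = fun p => (em p : ℤ) := funext h2
  rw [e1, e2, ser_lsum2 _ _ hp, ser_lsum2 _ _ hm, ← lsum_add]
  congr 1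
  funext t
  rw [sub_eq_add_neg]
  congr 1
  · congr 1
    funext i
    simp [cN_fp]
  · rw [← lsum_neg]
    congr 1
    funext i
    simp [cN_fm]

theorem tri_fp (i : ℕ) : tri ((i : ℤ) + 1) = tn i + i + 1 := by
  have h1 := two_tri ((i : ℤ) + 1)
  have h2 : (2 * (tn i : ℤ)) = i * (i + 1) := by exact_mod_cast two_tn i
  linarith
theorem tri_fm (i : ℕ) : tri (-((i : ℤ) + 1)) = tn i := by
  have h1 := two_tri (-((i : ℤ) + 1))
  have h2 : (2 * (tn i : ℤ)) = i * (i + 1) := by exact_mod_cast two_tn i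
  linarith

theorem le_aux (m i t : ℕ) (h : t ≤ m) (x : ℕ) : i ≤ tn i + x + m * (i + 1) ∧ t ≤ tn i + x + m * (i + 1) := by
  have := tn_ge i
  have h2 := Nat.zero_le (m * i)
  rw [mul_add]
  omega

theorem sB_eq : sB = lsum fun t => kk (2 + 4 * t) - kk (3 + 4 * t) := by
  unfold sB
  rw [ser_cN adm_eB (fun p => tn p.1 + (2 + 4 * p.2) * (p.1 + 1))
    (fun p => tn p.1 + (3 + 4 * p.2) * (p.1 + 1))
    (fun i t => by simpa using le_aux (2 + 4 * t) i t (by omega) 0)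
    (fun i t => by simpa using le_aux (3 + 4 * t) i t (by omega) 0)]
  · rfl
  · rintro ⟨i, t⟩
    simp only [eB, fp, tri_fp]; push_cast; ring
  · rintro ⟨i, t⟩
    simp only [eB, fm, tri_fm]; push_cast; ring

theorem sA_eq0 : sA 0 = lsum fun t => hh (3 + 8 * t) - hh (6 + 8 * t) := by
  unfold sA
  rw [ser_cN (adm_eA 0 (by norm_num) (by norm_num))
    (fun p => tn p.1 + (p.1 + 1) ^ 2 + (3 + 8 * p.2) * (p.1 + 1))
    (fun p => tn p.1 + (p.1 + 1) ^ 2 + (6 + 8 * p.2) * (p.1 + 1))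
    (fun i t => le_aux (3 + 8 * t) i t (by omega) _)
    (fun i t => le_aux (6 + 8 * t) i t (by omega) _)]
  · rfl
  · rintro ⟨i, t⟩
    simp only [eA, fp, tri_fp]; push_cast; ring
  · rintro ⟨i, t⟩
    simp only [eA, fm, tri_fm]; push_cast; ring

theorem sA_eq1 : sA 1 = lsum fun t => hh (4 + 8 * t) - hh (5 + 8 * t) := by
  unfold sA
  rw [ser_cN (adm_eA 1 (by norm_num) (by norm_num))
    (fun p => tn p.1 + (p.1 + 1) ^ 2 + (4 + 8 * p.2) * (p.1 + 1))
    (fun p => tn p.1 + (p.1 + 1) ^ 2 + (5 + 8 * p.2) * (p.1 + 1))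
    (fun i t => le_aux (4 + 8 * t) i t (by omega) _)
    (fun i t => le_aux (5 + 8 * t) i t (by omega) _)]
  · rfl
  · rintro ⟨i, t⟩
    simp only [eA, fp, tri_fp]; push_cast; ring
  · rintro ⟨i, t⟩
    simp only [eA, fm, tri_fm]; push_cast; ring

theorem rank_crank : (gq fun s => rk s % 8 = 3) - (gq fun s => crk s % 8 = 2) =
    PP * (sA 0 - sA 1 - sB) := by
  rw [rank_series, crank_series, sA_eq0, sA_eq1, sB_eq, ← lsum_sub, ← mul_sub]
  congr 2
  congr 1
  funext t; ring

theorem psi_lsum : psi = lsum fun a => X ^ tn (2 * a) + X ^ tn (2 * a + 1) := by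
  have hadm : Adm T (fun _ => 1) := adm1 T_ge _
  unfold psi
  rw [split_ser (f := fun a : ℕ => (a : ℤ)) (g := fun a : ℕ => -((a : ℤ) + 1))
    (by intro a b h; simpa using h) (by intro a b h; simpa using h)
    (by intro a b h; omega) hadm (by
      intro p _
      rcases le_or_gt 0 p with h | h
      · left; exact ⟨p.toNat, by omega⟩
      · right; exact ⟨(-p - 1).toNat, by omega⟩)]
  have e1 : (T ∘ fun a : ℕ => (a : ℤ)) = fun a : ℕ => ((tn (2 * a) : ℕ) : ℤ) := by
    funext a
    have h2 : (2 * (tn (2 * a) : ℤ)) = (2 * a) * (2 * a + 1) := by exact_mod_cast two_tn (2 * a)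
    simp only [Function.comp, T]; linarith
  have e2 : (T ∘ fun a : ℕ => -((a : ℤ) + 1)) = fun a : ℕ => ((tn (2 * a + 1) : ℕ) : ℤ) := by
    funext a
    have h2 : (2 * (tn (2 * a + 1) : ℤ)) = (2 * a + 1) * (2 * a + 1 + 1) := by
      exact_mod_cast two_tn (2 * a + 1)
    simp only [Function.comp, T]; linarith
  rw [e1, e2, ser_lsum _ _ (fun ν => by have := tn_ge (2 * ν); omega),
    ser_lsum _ _ (fun ν => by have := tn_ge (2 * ν + 1); omega), ← lsum_add]
  simp
end RC

namespace RC
open PowerSeries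
open scoped Classical

noncomputable def Od (n : ℕ) : ℤ⟦X⟧ := ∏ k ∈ Finset.range n, (1 - X ^ (2 * k + 1))
noncomputable def Rr (s n : ℕ) : ℤ⟦X⟧ := ∏ k ∈ Finset.Ico s n, (1 - X ^ (2 * k + 2))
noncomputable def tt (n s : ℕ) : ℤ⟦X⟧ := Rr s n * Od s * X ^ (s * (2 * n + 1))

theorem Od_succ (n : ℕ) : Od (n + 1) = Od n * (1 - X ^ (2 * n + 1)) := Finset.prod_range_succ _ _
theorem Rr_top {s n : ℕ} (h : s ≤ n) : Rr s (n + 1) = Rr s n * (1 - X ^ (2 * n + 2)) :=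
  Finset.prod_Ico_succ_top h _
theorem Rr_bot {s n : ℕ} (h : s < n) : Rr s n = (1 - X ^ (2 * s + 2)) * Rr (s + 1) n :=
  Finset.prod_eq_prod_Ico_succ_bot h _
theorem Rr_self (n : ℕ) : Rr n n = 1 := by simp [Rr]

theorem tt_succ {n s : ℕ} (h : s ≤ n) : tt (n + 1) s = (1 - X ^ (2 * n + 2)) * X ^ (2 * s) * tt n s := by
  unfold tt
  rw [Rr_top h, show s * (2 * (n + 1) + 1) = 2 * s + s * (2 * n + 1) by ring, pow_add]
  ring

theorem tt_step {n s : ℕ} (h : s < n) :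
    tt n (s + 1) * (1 - X ^ (2 * s + 2)) = tt n s * ((1 - X ^ (2 * s + 1)) * X ^ (2 * n + 1)) := by
  unfold tt
  rw [Rr_bot h, Od_succ, show (s + 1) * (2 * n + 1) = s * (2 * n + 1) + (2 * n + 1) by ring, pow_add]
  ring

theorem tt_tele (n m : ℕ) (h : m ≤ n) :
    ∑ s ∈ Finset.range m, (tt (n + 1) s - (1 - X ^ (2 * n + 1)) * tt n s) =
      tt n m * (1 - X ^ (2 * m)) := by
  induction m with
  | zero => simp
  | succ m ih =>
    have h1 := tt_step (n := n) (s := m) (by omega)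
    rw [Finset.sum_range_succ, ih (by omega), tt_succ (by omega),
      show 2 * (m + 1) = 2 * m + 2 by ring, h1]
    ring

theorem shanks (n : ℕ) : ∑ s ∈ Finset.range n, tt n s =
    Od n * ∑ a ∈ Finset.range n, (X ^ tn (2 * a) + X ^ tn (2 * a + 1)) := by
  induction n with
  | zero => simp
  | succ n ih =>
    have h1 := tt_tele n n le_rfl
    rw [Finset.sum_sub_distrib, ← Finset.mul_sum, ih] at h1
    have h2 : tt (n + 1) n = (1 - X ^ (2 * n + 2)) * X ^ (2 * n) * tt n n := tt_succ le_rfl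
    have h3 : tt n n = Od n * X ^ (n * (2 * n + 1)) := by unfold tt; rw [Rr_self, one_mul]
    have e1 : tn (2 * n) = n * (2 * n + 1) := by have := two_tn (2 * n); nlinarith
    have e2 : tn (2 * n + 1) = n * (2 * n + 1) + (2 * n + 1) := by have := two_tn (2 * n + 1); nlinarith
    rw [Finset.sum_range_succ, Finset.sum_range_succ, h2, Od_succ, e1, e2, pow_add _ _ (2 * n + 1)]
    rw [h3] at h1 ⊢
    linear_combination h1

theorem tt_dvd (n : ℕ) (hn : 1 ≤ n) : X ^ n ∣ (∑ s ∈ Finset.range n, tt n s) - Rr 0 n := by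
  obtain ⟨m, rfl⟩ : ∃ m, n = m + 1 := ⟨n - 1, by omega⟩
  rw [Finset.sum_range_succ']
  have : tt (m + 1) 0 = Rr 0 (m + 1) := by simp [tt, Od]
  rw [this, add_sub_cancel_right]
  refine Finset.dvd_sum fun s _ => ?_
  unfold tt
  refine Dvd.dvd.mul_left (pow_dvd_pow _ ?_) _
  nlinarith [Nat.zero_le (s * (2 * (m + 1) + 1))]

theorem eP_prod (n : ℕ) : eP (2 * n) * Od n * Rr 0 n = 1 := by
  induction n with
  | zero => simp [eP_zero, Od, Rr]
  | succ n ih =>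
    have h1 := eP_succ (2 * n)
    have h2 := eP_succ (2 * n + 1)
    rw [Od_succ, Rr_top (Nat.zero_le _), show 2 * (n + 1) = 2 * n + 1 + 1 by ring]
    rw [← h1, ← h2] at ih
    linear_combination ih

theorem ex_mul (d : ℕ) [NeZero d] (F G : ℤ⟦X⟧) : ex d (F * G) = ex d F * ex d G := map_mul _ _ _
theorem ex_pow (d : ℕ) [NeZero d] (F : ℤ⟦X⟧) (n : ℕ) : ex d (F ^ n) = ex d F ^ n := map_pow _ _ _
theorem ex_X (d : ℕ) [NeZero d] : ex d (X : ℤ⟦X⟧) = X ^ d := expand_X _ _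

theorem ex_eP (n : ℕ) : ex 2 (eP n) * Rr 0 n = 1 := by
  induction n with
  | zero => simp [eP_zero, Rr]
  | succ n ih =>
    have h1 : (1 - X ^ (2 * n + 2)) * ex 2 (eP (n + 1)) = ex 2 (eP n) := by
      have h := congrArg (ex 2) (eP_succ n)
      rw [ex_mul] at h
      rw [← h]
      congr 1
      simp only [ex, map_sub, map_one, map_pow, expand_X]
      ring
    rw [← h1] at ih; rw [Rr_top (Nat.zero_le _)]; linear_combination ih

theorem psi_PP : psi * ex 2 PP ^ 2 = PP := by
  rw [← sub_eq_zero]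
  apply eq_zero_of_dvd
  intro M
  suffices h : ∀ n, 1 ≤ n → X ^ n ∣ psi * ex 2 PP ^ 2 - PP from
    (pow_dvd_pow _ (Nat.le_succ M)).trans (h (M + 1) (by omega))
  intro n hn
  have h1 : X ^ n ∣ psi - ∑ a ∈ Finset.range n, (X ^ tn (2 * a) + X ^ tn (2 * a + 1)) := by
    rw [psi_lsum]
    refine lsum_sub_dvd (fun ν => dvd_add (pow_dvd_pow _ ?_) (pow_dvd_pow _ ?_)) n
    · have := tn_ge (2 * ν); omega
    · have := tn_ge (2 * ν + 1); omega
  have h2 := tt_dvd n hn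
  rw [shanks] at h2
  have h3 : X ^ n ∣ PP - eP (2 * n) := (pow_dvd_pow _ (by omega)).trans (PP_eP (2 * n))
  have h4 : X ^ n ∣ ex 2 PP - ex 2 (eP n) := by
    obtain ⟨c, hc⟩ := PP_eP n
    have := congrArg (ex 2) hc
    rw [ex_mul, ex_pow, ex_X, ← pow_mul] at this
    simp only [ex, map_sub] at this ⊢
    rw [this]
    exact Dvd.dvd.mul_right (pow_dvd_pow _ (by omega)) _
  have h5 := eP_prod n
  have h6 := ex_eP n
  have h7 : eP (2 * n) * Od n = ex 2 (eP n) := by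
    linear_combination ex 2 (eP n) * h5 - eP (2 * n) * Od n * h6
  obtain ⟨a, ha⟩ := h1
  obtain ⟨b, hb⟩ := h2
  obtain ⟨c, hc⟩ := h3
  obtain ⟨d, hd⟩ := h4
  have ha' := sub_eq_iff_eq_add.1 ha
  have h8 : psi * ex 2 (eP n) ^ 2 - eP (2 * n) =
      X ^ n * (a * ex 2 (eP n) ^ 2 + b * eP (2 * n) * ex 2 (eP n)) := by
    linear_combination ex 2 (eP n) ^ 2 * ha + eP (2 * n) * ex 2 (eP n) * hb + eP (2 * n) * h6 -
      (∑ a ∈ Finset.range n, (X ^ tn (2 * a) + X ^ tn (2 * a + 1))) * ex 2 (eP n) * h7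
  refine ⟨a * ex 2 (eP n) ^ 2 + b * eP (2 * n) * ex 2 (eP n) - c + psi * d * (ex 2 PP + ex 2 (eP n)), ?_⟩
  linear_combination h8 - hc + psi * (ex 2 PP + ex 2 (eP n)) * hd

theorem theta_PP : PP * ex 2 (ex 2 (ex 2 PP)) ^ 2 = Th * ex 2 (ex 2 PP) ^ 5 := by
  have h1 := psi_PP
  have h2 := psi_sq
  have h3 := congrArg (ex 2) h1
  rw [ex_mul, ex_pow] at h3
  have h4 : PP ^ 2 * ex 2 (ex 2 PP) ^ 2 = phi * ex 2 PP ^ 5 := by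
    linear_combination (-(PP + psi * ex 2 PP ^ 2) * ex 2 (ex 2 PP) ^ 2) * h1 +
      ex 2 PP ^ 4 * ex 2 (ex 2 PP) ^ 2 * h2 + phi * ex 2 PP ^ 4 * h3
  have h5 := congrArg (ex 2) h4
  simp only [ex_mul, ex_pow] at h5
  unfold Th
  linear_combination (- ex 2 (ex 2 (ex 2 PP)) ^ 2) * h1 + psi * h5

theorem vanish_mul {F : ℤ⟦X⟧} (G : ℤ⟦X⟧) (h : ∀ N, N % 4 = 0 ∨ N % 4 = 1 → coeff N F = 0) (N : ℕ)
    (hN : N % 4 = 0 ∨ N % 4 = 1) : coeff N (F * ex 4 G) = 0 := by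
  rw [coeff_mul]
  refine Finset.sum_eq_zero fun p hp => ?_
  have hp := Finset.HasAntidiagonal.mem_antidiagonal.1 hp
  by_cases h4 : 4 ∣ p.2
  · rw [h p.1 (by omega), zero_mul]
  · rw [ex, coeff_expand_of_not_dvd _ _ _ h4, mul_zero]

theorem ex_four (F : ℤ⟦X⟧) : ex 2 (ex 2 F) = ex 4 F := (expand_mul 2 _ 2 _ F).symm

theorem PP_c0 : constantCoeff PP = 1 := by
  have := PP_eP 0
  rw [eP_zero, X_pow_dvd_iff] at this
  have := this 0 (by omega)
  simp at this
  linarith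

theorem main_coeff (N : ℕ) (hN : N % 4 = 0 ∨ N % 4 = 1) : coeff N (PP * (sA 0 - sA 1 - sB)) = 0 := by
  have hG : constantCoeff (ex 2 PP ^ 2) = ((1 : ℤˣ) : ℤ) := by
    rw [map_pow, ex_c0 2 PP_c0]; simp
  have hinv := congrArg (ex 4) (mul_invOfUnit (ex 2 PP ^ 2) 1 hG)
  rw [ex_mul] at hinv
  have h1 : ex 4 (1 : ℤ⟦X⟧) = 1 := map_one _
  rw [h1] at hinv
  have h2 := theta_PP
  rw [ex_four, ex_four, ← ex_pow 4, ← ex_pow 4] at h2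
  have key : PP * (sA 0 - sA 1 - sB) = (Th * (sA 0 - sA 1 - sB)) * ex 4 (PP ^ 5) *
      ex 4 (invOfUnit (ex 2 PP ^ 2) 1) := by
    linear_combination (-(PP * (sA 0 - sA 1 - sB))) * hinv +
      (sA 0 - sA 1 - sB) * ex 4 (invOfUnit (ex 2 PP ^ 2) 1) * h2
  rw [key]
  exact vanish_mul _ (vanish_mul _ coeff_Th) N hN

theorem rank_count (n : ℕ) : ((rankCount 3 8 n : ℕ) : ℤ) = coeff n (gq fun s => rk s % 8 = 3) := by
  rw [coeff_gq, rankCount]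
  congr 2
  ext π
  simp only [Finset.mem_filter, Finset.mem_univ, true_and]
  change rk π.parts % 8 = 3 ↔ _
  rfl

theorem crank_count (n : ℕ) : ((crankCount 2 8 n : ℕ) : ℤ) = coeff n (gq fun s => crk s % 8 = 2) := by
  rw [coeff_gq, crankCount]
  congr 2
  ext π
  simp only [Finset.mem_filter, Finset.mem_univ, true_and]
  have : partitionCrank π = crk π.parts := by
    unfold partitionCrank crk
    congr
  rw [this]
  rfl

theorem main_eq (n : ℕ) (hn : n % 4 = 0 ∨ n % 4 = 1) : rankCount 3 8 n = crankCount 2 8 n := by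
  have h := main_coeff n hn
  rw [← rank_crank, map_sub, ← rank_count, ← crank_count] at h
  omega

end RC

theorem stmt_18 :
    (∀ n : ℕ, 1 ≤ n → rankCount 3 8 (4 * n) = crankCount 2 8 (4 * n)) ∧
    (∀ n : ℕ, rankCount 3 8 (4 * n + 1) = crankCount 2 8 (4 * n + 1)) := by
  exact ⟨fun n _ => RC.main_eq _ (by omega), fun n => RC.main_eq _ (by omega)⟩
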